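/- arXiv:2510.06792 — 2 statements merged into one kernel-verified Lean document; each statement's English description precedes it below -/
import Mathlib

section
/- Let s, t ∈ ℂ with s² ≠ 4 and let f(x,y) = x⁴ + s x²y³ + t x²y⁴ + y⁶ (the family W_{1,0}). Then f does not deform to J_{3,0}: for every integer m ≥ 1 and every function F(x,y,u), analytic on a neighborhood of 0 in ℂ² × ℂ^m, with F(x,y,0) = f(x,y), there exists ε > 0 such that for every u ∈ ℂ^m with 0 < ‖u‖ < ε, the germ at 0 of (x,y) ↦ F(x,y,u) is not right equivalent to the germ at 0 of x³ + b x²y³ + y⁹ + c x y⁷ for any b, c ∈ ℂ with 4b³ + 27 ≠ 0. -/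
open Filter

/-- The germs at `0` of `g₁` and `g₂` are (smoothly/holomorphically) right equivalent:
there is a map `φ`, analytic on a neighborhood of `0`, with `φ 0 = 0` and invertible
derivative at `0`, such that `g₁ = g₂ ∘ φ` near `0`. -/
def RightEquiv (g₁ g₂ : ℂ × ℂ → ℂ) : Prop :=
  ∃ φ : ℂ × ℂ → ℂ × ℂ, φ 0 = 0 ∧ AnalyticAt ℂ φ 0 ∧
    (∃ L : (ℂ × ℂ) ≃L[ℂ] ℂ × ℂ, fderiv ℂ φ 0 = (L : (ℂ × ℂ) →L[ℂ] ℂ × ℂ)) ∧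
    ∀ᶠ p in nhds (0 : ℂ × ℂ), g₁ p = g₂ (φ p)

/-- The normal form `x³ + b x² y³ + y⁹ + c x y⁷` of the class `J_{3,0}`. -/
noncomputable def J30 (b c : ℂ) (p : ℂ × ℂ) : ℂ :=
  p.1 ^ 3 + b * p.1 ^ 2 * p.2 ^ 3 + p.2 ^ 9 + c * p.1 * p.2 ^ 7

open Topology Asymptotics

theorem MultilinearMap.map_diag_smul_add_smul {V : Type*} [AddCommGroup V] [Module ℂ V] (k : ℕ)
    (M : MultilinearMap ℂ (fun _ : Fin k => V) ℂ) (e₁ e₂ : V) (x y : ℂ) :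
    M (fun _ => x • e₁ + y • e₂) =
      ∑ j ∈ Finset.range (k + 1), (∑ s : Finset (Fin k) with s.card = j,
        M (s.piecewise (fun _ => e₁) (fun _ => e₂))) * x ^ j * y ^ (k - j) := by
  have h1 : M (fun _ => x • e₁ + y • e₂) = ∑ s : Finset (Fin k),
      x ^ s.card * y ^ (k - s.card) * M (s.piecewise (fun _ => e₁) (fun _ => e₂)) := by
    have := M.map_add_univ (fun _ => x • e₁) (fun _ => y • e₂)
    refine (this.trans ?_)
    refine Finset.sum_congr rfl fun s _ => ?_
    have h2 : s.piecewise (fun _ => x • e₁) (fun _ => y • e₂) =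
        fun i => (s.piecewise (fun _ => x) (fun _ => y) i) •
          s.piecewise (fun _ => e₁) (fun _ => e₂) i := by
      funext i
      by_cases hi : i ∈ s <;> simp [hi]
    rw [h2, M.map_smul_univ, Finset.prod_piecewise]
    simp [Finset.card_sdiff]
  rw [h1, ← Finset.sum_fiberwise_of_maps_to (s := Finset.univ) (t := Finset.range (k + 1))
    (g := Finset.card)]
  · refine Finset.sum_congr rfl fun j _ => ?_
    rw [Finset.sum_mul, Finset.sum_mul]
    refine Finset.sum_congr rfl fun s hs => ?_
    rw [(Finset.mem_filter.1 hs).2]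
    ring
  · intro s _
    have := s.card_le_univ
    simp at this ⊢
    omega

/-- An analytic function of `(x, y, u)` has a Taylor expansion in `(x, y)` whose coefficients are
continuous in `u`. -/
theorem exists_taylor_coeff {E : Type*} [NormedAddCommGroup E] [NormedSpace ℂ E]
    (F : (ℂ × ℂ) × E → ℂ) (hF : AnalyticAt ℂ F 0) (N : ℕ) :
    ∃ c : ℕ → ℕ → E → ℂ, (∀ k j, ContinuousAt (c k j) 0) ∧ ∀ᶠ u in 𝓝 (0 : E),
      (fun v : ℂ × ℂ => F (v, u) - ∑ k ∈ Finset.range N, ∑ j ∈ Finset.range (k + 1),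
        c k j u * v.1 ^ j * v.2 ^ (k - j)) =O[𝓝 0] fun v => ‖v‖ ^ N := by
  let e₁ : (ℂ × ℂ) × E := ((1, 0), 0)
  let e₂ : (ℂ × ℂ) × E := ((0, 1), 0)
  have hι : ContinuousAt (fun u : E => (((0 : ℂ × ℂ), u) : (ℂ × ℂ) × E)) 0 := by fun_prop
  refine ⟨fun k j u => (k.factorial : ℂ)⁻¹ * ∑ s : Finset (Fin k) with s.card = j,
    iteratedFDeriv ℂ k F (0, u) (s.piecewise (fun _ => e₁) (fun _ => e₂)), ?_, ?_⟩
  · intro k j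
    refine continuousAt_const.mul (tendsto_finsetSum _ fun s _ => ?_)
    have h : ContinuousAt (fun u : E => iteratedFDeriv ℂ k F (0, u)) 0 :=
      ContinuousAt.comp (g := iteratedFDeriv ℂ k F) (hF.contDiffAt.iteratedFDeriv_right
        (m := 0) (i := k) le_top).continuousAt hι
    exact ((ContinuousMultilinearMap.apply ℂ (fun _ : Fin k => (ℂ × ℂ) × E) ℂ
      (s.piecewise (fun _ => e₁) (fun _ => e₂))).continuous.continuousAt).comp h
  · filter_upwards [hι.eventually hF.eventually_analyticAt] with u hu
    obtain ⟨p, r, hp⟩ := hu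
    have hO := hp.hasFPowerSeriesAt.isBigO_sub_partialSum_pow N
    have hT : Tendsto (fun v : ℂ × ℂ => ((v, 0) : (ℂ × ℂ) × E)) (𝓝 0) (𝓝 0) := by
      have : ContinuousAt (fun v : ℂ × ℂ => ((v, 0) : (ℂ × ℂ) × E)) 0 := by fun_prop
      exact this
    have hO' := hO.comp_tendsto hT
    refine (hO'.congr_left fun v => ?_).trans (IsBigO.of_bound 1 (by simp))
    simp only [Function.comp, Prod.mk_add_mk, zero_add, add_zero]
    congr 1
    refine Finset.sum_congr rfl fun k _ => ?_
    have h1 := hp.factorial_smul ((v, 0) : (ℂ × ℂ) × E) k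
    have h2 : ((v, 0) : (ℂ × ℂ) × E) = v.1 • e₁ + v.2 • e₂ := by
      simp [e₁, e₂]
    have h3 := MultilinearMap.map_diag_smul_add_smul k
      (iteratedFDeriv ℂ k F (0, u)).toMultilinearMap e₁ e₂ v.1 v.2
    rw [← h2] at h3
    have hk : (k.factorial : ℂ) ≠ 0 := by exact_mod_cast k.factorial_ne_zero
    have h4 : p k (fun _ => (v, 0)) = (k.factorial : ℂ)⁻¹ *
        iteratedFDeriv ℂ k F (0, u) (fun _ => (v, 0)) := by
      rw [← h1, nsmul_eq_mul, inv_mul_cancel_left₀ hk]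
    rw [h4]
    refine (congrArg ((k.factorial : ℂ)⁻¹ * ·) h3).trans ?_
    rw [Finset.mul_sum]
    refine Finset.sum_congr rfl fun j _ => ?_
    simp only [← mul_assoc]
    rfl

theorem coeff_eq_zero_of_isBigO (P : Polynomial ℂ) (N : ℕ)
    (h : (fun τ : ℂ => P.eval τ) =O[𝓝[≠] 0] fun τ => τ ^ N) : ∀ n < N, P.coeff n = 0 := by
  suffices h' : Polynomial.X ^ N ∣ P from Polynomial.X_pow_dvd_iff.1 h'
  induction N generalizing P with
  | zero => simp
  | succ N ih =>
    have h0 : P.eval 0 = 0 := by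
      have h1 : Tendsto (fun τ : ℂ => τ ^ (N + 1)) (𝓝[≠] 0) (𝓝 0) := by
        have : ContinuousAt (fun τ : ℂ => τ ^ (N + 1)) 0 := by fun_prop
        simpa [ContinuousAt] using this.tendsto.mono_left (nhdsWithin_le_nhds (s := {0}ᶜ))
      exact tendsto_nhds_unique
        ((P.continuous.tendsto 0).mono_left nhdsWithin_le_nhds) (h.trans_tendsto h1)
    obtain ⟨Q, rfl⟩ := Polynomial.X_dvd_iff.2
      ((Polynomial.coeff_zero_eq_eval_zero P).trans h0)
    rw [pow_succ']
    refine mul_dvd_mul_left _ (ih Q ?_)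
    have h2 := (isBigO_refl (fun τ : ℂ => τ⁻¹) (𝓝[≠] 0)).mul h
    refine h2.congr' ?_ ?_ <;>
    · filter_upwards [self_mem_nhdsWithin] with τ hτ
      have hτ : τ ≠ 0 := hτ
      simp [pow_succ']
      field_simp

theorem coeff_C_add_C_mul_X_pow (p a : ℂ) (j n : ℕ) :
    ((Polynomial.C p + Polynomial.C a * Polynomial.X) ^ j).coeff n =
      j.choose n * p ^ (j - n) * a ^ n := by
  have : (Polynomial.C p + Polynomial.C a * Polynomial.X) ^ j =
      ((Polynomial.X + Polynomial.C p) ^ j).comp (Polynomial.C a * Polynomial.X) := by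
    simp [add_comm]
  rw [this, Polynomial.comp_C_mul_X_coeff, Polynomial.coeff_X_add_C_pow]
  ring

open Polynomial in
/-- If a polynomial in two variables vanishes to order `N` along the curve `(p τ + a τ², τ)`,
then the first `N` coefficients of its restriction to that curve are zero. -/
theorem curve_coeff_eq_zero (d : ℕ → ℕ → ℂ) (M N : ℕ) (p a : ℂ)
    (h : (fun τ : ℂ => ∑ k ∈ Finset.range M, ∑ j ∈ Finset.range (k + 1),
      d k j * (p * τ + a * τ ^ 2) ^ j * τ ^ (k - j)) =O[𝓝 0] fun τ => τ ^ N)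
    (n : ℕ) (hn : n < N) (hnM : n < M) :
    ∑ k ∈ Finset.range (n + 1), ∑ j ∈ Finset.range (k + 1),
      d k j * (j.choose (n - k) * p ^ (j - (n - k)) * a ^ (n - k)) = 0 := by
  let P : ℂ[X] := ∑ k ∈ Finset.range M, ∑ j ∈ Finset.range (k + 1),
      C (d k j) * (C p + C a * X) ^ j * X ^ k
  have hP : ∀ n < N, P.coeff n = 0 := by
    refine coeff_eq_zero_of_isBigO P N ((h.mono nhdsWithin_le_nhds).congr_left fun τ => ?_)
    simp only [P, eval_finsetSum]
    refine Finset.sum_congr rfl fun k _ => Finset.sum_congr rfl fun j hj => ?_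
    have hkj : τ ^ k = τ ^ j * τ ^ (k - j) := by
      rw [← pow_add]
      congr 1
      have := Finset.mem_range.1 hj
      omega
    simp only [eval_mul, eval_pow, eval_add, eval_C, eval_X]
    rw [hkj, show p * τ + a * τ ^ 2 = (p + a * τ) * τ by ring, mul_pow]
    ring
  have h2 := hP n hn
  simp only [P, finsetSum_coeff, coeff_mul_X_pow', coeff_C_mul, coeff_C_add_C_mul_X_pow] at h2
  rw [← h2]
  refine Finset.sum_subset_zero_on_sdiff (Finset.range_mono hnM) ?_ ?_
  · intro k hk
    have : ¬ k ≤ n := by simp at hk; omega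
    simp [this]
  · intro k hk
    have : k ≤ n := by simp at hk; omega
    simp [this]

theorem isBigO_pow_of_continuous (r : ℂ → ℂ) (hr : Continuous r) (n : ℕ) :
    (fun τ => τ ^ n * r τ) =O[𝓝 0] fun τ : ℂ => τ ^ n := by
  simpa using (isBigO_refl (fun τ : ℂ => τ ^ n) (𝓝 0)).mul
    ((hr.tendsto 0).isBigO_one ℂ)

theorem parabola_tendsto_zero (p a : ℂ) :
    Tendsto (fun τ : ℂ => (p * τ + a * τ ^ 2, τ)) (𝓝 0) (𝓝 (0 : ℂ × ℂ)) := by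
  have h : Continuous fun τ : ℂ => (p * τ + a * τ ^ 2, τ) := by fun_prop
  have h0 := h.tendsto 0
  simp only [mul_zero, ne_eq, OfNat.ofNat_ne_zero, not_false_eq_true, zero_pow, add_zero] at h0
  exact h0

theorem parabola_norm_pow_isBigO (p a : ℂ) (n : ℕ) :
    (fun τ : ℂ => ‖((p * τ + a * τ ^ 2, τ) : ℂ × ℂ)‖ ^ n) =O[𝓝 0] fun τ : ℂ => τ ^ n := by
  refine IsBigO.pow (IsBigO.norm_left (IsBigO.prod_left ?_ (isBigO_refl _ _))) n
  have h := isBigO_pow_of_continuous (fun τ => p + a * τ) (by fun_prop) 1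
  simp only [pow_one] at h
  exact h.congr_left fun τ => by ring


/-- If `g` agrees near `0` with a member of `J_{3,0}` evaluated at `(ψ, χ)`, and the linear part of
`ψ` is `A x + B y` with `|B| ≤ |A|`, then `g` vanishes to order `9` along the parabola that
osculates `ψ = 0`, its `2`-jet is zero and its `3`-jet is the cube of the linear part of `ψ`. -/
theorem J30_curve_equations (g ψ χ : ℂ × ℂ → ℂ) (b c A B q₀ q₁ q₂ : ℂ) (d : ℕ → ℕ → ℂ)
    (hAB : ‖B‖ ≤ ‖A‖) (hA : A ≠ 0)
    (hψ : (fun v : ℂ × ℂ => ψ v - (A * v.1 + B * v.2 + q₀ * v.1 ^ 2 + q₁ * v.1 * v.2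
      + q₂ * v.2 ^ 2)) =O[𝓝 0] fun v => ‖v‖ ^ 3)
    (hχ : χ =O[𝓝 0] fun v => ‖v‖)
    (hg : ∀ᶠ v in 𝓝 0, g v = J30 b c (ψ v, χ v))
    (hd : (fun v : ℂ × ℂ => g v - ∑ k ∈ Finset.range 9, ∑ j ∈ Finset.range (k + 1),
        d k j * v.1 ^ j * v.2 ^ (k - j)) =O[𝓝 0] fun v => ‖v‖ ^ 9) :
    ∃ p a : ℂ, ‖p‖ ≤ 1 ∧
      (∀ n < 9, ∑ k ∈ Finset.range (n + 1), ∑ j ∈ Finset.range (k + 1),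
        d k j * (j.choose (n - k) * p ^ (j - (n - k)) * a ^ (n - k)) = 0) ∧
      (∀ q, ∑ j ∈ Finset.range 3, d 2 j * q ^ j = 0) ∧
      (∀ q, ∑ j ∈ Finset.range 4, d 3 j * q ^ j = (A * (q - p)) ^ 3) := by
  have hχc : ∀ p a : ℂ, (fun τ : ℂ => χ (p * τ + a * τ ^ 2, τ)) =O[𝓝 0] fun τ : ℂ => τ :=
    fun p a => (hχ.comp_tendsto (parabola_tendsto_zero p a)).trans
      ((parabola_norm_pow_isBigO p a 1).congr (fun _ => pow_one _) fun _ => pow_one _)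
  have hψc := fun p a : ℂ => (hψ.comp_tendsto (parabola_tendsto_zero p a)).trans
    (parabola_norm_pow_isBigO p a 3)
  have hgc := fun p a : ℂ => (parabola_tendsto_zero p a).eventually hg
  have hdc := fun p a : ℂ => (hd.comp_tendsto (parabola_tendsto_zero p a)).trans
    (parabola_norm_pow_isBigO p a 9)
  have hpow : ∀ {m n : ℕ}, m ≤ n → (fun τ : ℂ => τ ^ n) =O[𝓝 0] fun τ : ℂ => τ ^ m := by
    intro m n hmn
    refine (isBigO_pow_of_continuous (fun τ => τ ^ (n - m)) (by fun_prop) m).congr_left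
      fun τ => ?_
    rw [← pow_add]
    congr 1
    omega
  have hline : ∀ q n, n < 4 → ∑ k ∈ Finset.range (n + 1), ∑ j ∈ Finset.range (k + 1),
        (d k j - if k = 3 ∧ j = 0 then (A * q + B) ^ 3 else 0) *
          (j.choose (n - k) * q ^ (j - (n - k)) * 0 ^ (n - k)) = 0 := by
    intro q n hn
    refine curve_coeff_eq_zero _ 9 4 q 0 ?_ n hn (by omega)
    have h1 : (fun τ : ℂ => ψ (q * τ + 0 * τ ^ 2, τ) - (A * q + B) * τ) =O[𝓝 0]
        fun τ : ℂ => τ ^ 2 := by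
      refine (((hψc q 0).trans (hpow (by norm_num : 2 ≤ 3))).add (isBigO_pow_of_continuous
        (fun _ => q₀ * q ^ 2 + q₁ * q + q₂) (by fun_prop) 2)).congr_left fun τ => ?_
      simp only [Function.comp]
      ring
    have hx : (fun τ : ℂ => ψ (q * τ + 0 * τ ^ 2, τ)) =O[𝓝 0] fun τ : ℂ => τ ^ 1 := by
      refine ((h1.trans (hpow (by norm_num : 1 ≤ 2))).add (isBigO_pow_of_continuous
        (fun _ => A * q + B) (by fun_prop) 1)).congr_left fun τ => ?_
      ring
    have hy : (fun τ : ℂ => χ (q * τ + 0 * τ ^ 2, τ)) =O[𝓝 0] fun τ : ℂ => τ ^ 1 := by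
      simpa using hχc q 0
    set x : ℂ → ℂ := fun τ => ψ (q * τ + 0 * τ ^ 2, τ) with hxdef
    set y : ℂ → ℂ := fun τ => χ (q * τ + 0 * τ ^ 2, τ) with hydef
    have hl : (fun τ : ℂ => (A * q + B) * τ) =O[𝓝 0] fun τ : ℂ => τ ^ 1 := by
      simpa using isBigO_const_mul_self (A * q + B) (fun τ : ℂ => τ) (𝓝 0)
    have e1 : (fun τ => x τ ^ 3 - ((A * q + B) * τ) ^ 3) =O[𝓝 0] fun τ : ℂ => τ ^ 4 := by
      have := h1.mul (((hx.mul hx).add (hx.mul hl)).add (hl.mul hl))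
      exact (this.congr_left fun τ => by simp only [hxdef]; ring).congr_right fun τ => by ring
    have e2 : (fun τ => b * x τ ^ 2 * y τ ^ 3) =O[𝓝 0] fun τ : ℂ => τ ^ 4 := by
      have := (((hx.pow 2).const_mul_left b).mul (hy.pow 3))
      exact (this.congr_right fun τ => by ring : _ =O[_] fun τ : ℂ => τ ^ 5).trans
        (hpow (by norm_num))
    have e3 : (fun τ => y τ ^ 9) =O[𝓝 0] fun τ : ℂ => τ ^ 4 := by
      exact ((hy.pow 9).congr_right fun τ => by ring : _ =O[_] fun τ : ℂ => τ ^ 9).trans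
        (hpow (by norm_num))
    have e4 : (fun τ => c * x τ * y τ ^ 7) =O[𝓝 0] fun τ : ℂ => τ ^ 4 := by
      have := ((hx.const_mul_left c).mul (hy.pow 7))
      exact (this.congr_right fun τ => by ring : _ =O[_] fun τ : ℂ => τ ^ 8).trans
        (hpow (by norm_num))
    have e5 := (((e1.add e2).add e3).add e4).sub ((hdc q 0).trans (hpow (by norm_num : 4 ≤ 9)))
    refine e5.congr' ?_ EventuallyEq.rfl
    filter_upwards [hgc q 0] with τ hτ
    simp only [Function.comp, hτ, sub_mul, Finset.sum_sub_distrib, J30]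
    have : ∑ k ∈ Finset.range 9, ∑ j ∈ Finset.range (k + 1),
        (if k = 3 ∧ j = 0 then (A * q + B) ^ 3 else 0) * (q * τ + 0 * τ ^ 2) ^ j * τ ^ (k - j)
        = (A * q + B) ^ 3 * τ ^ 3 := by
      simp [Finset.sum_range_succ]
    rw [this]
    simp only [hxdef, hydef]
    ring
  have hp : A * (-B / A) + B = 0 := by field_simp; ring
  set p := -B / A with hpdef
  set a := -(q₀ * p ^ 2 + q₁ * p + q₂) / A with hadef
  have ha : A * a + (q₀ * p ^ 2 + q₁ * p + q₂) = 0 := by rw [hadef]; field_simp; ring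
  refine ⟨p, a, ?_, ?_, ?_, ?_⟩
  · rw [hpdef, norm_div, norm_neg]
    exact div_le_one_of_le₀ hAB (norm_nonneg _)
  · intro n hn
    refine curve_coeff_eq_zero _ 9 9 p a ?_ n hn hn
    have hx : (fun τ : ℂ => ψ (p * τ + a * τ ^ 2, τ)) =O[𝓝 0] fun τ : ℂ => τ ^ 3 := by
      refine ((hψc p a).add (isBigO_pow_of_continuous
        (fun τ => q₀ * (2 * p * a + a ^ 2 * τ) + q₁ * a) (by fun_prop) 3)).congr_left fun τ => ?_
      simp only [Function.comp]
      linear_combination (-τ) * hp - τ ^ 2 * ha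
    have hy : (fun τ : ℂ => χ (p * τ + a * τ ^ 2, τ)) =O[𝓝 0] fun τ : ℂ => τ ^ 1 := by
      simpa using hχc p a
    set x : ℂ → ℂ := fun τ => ψ (p * τ + a * τ ^ 2, τ)
    set y : ℂ → ℂ := fun τ => χ (p * τ + a * τ ^ 2, τ)
    have e1 : (fun τ => x τ ^ 3) =O[𝓝 0] fun τ : ℂ => τ ^ 9 :=
      (hx.pow 3).congr_right fun τ => by ring
    have e2 : (fun τ => b * x τ ^ 2 * y τ ^ 3) =O[𝓝 0] fun τ : ℂ => τ ^ 9 :=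
      (((hx.pow 2).const_mul_left b).mul (hy.pow 3)).congr_right fun τ => by ring
    have e3 : (fun τ => y τ ^ 9) =O[𝓝 0] fun τ : ℂ => τ ^ 9 :=
      (hy.pow 9).congr_right fun τ => by ring
    have e4 : (fun τ => c * x τ * y τ ^ 7) =O[𝓝 0] fun τ : ℂ => τ ^ 9 := by
      have := ((hx.const_mul_left c).mul (hy.pow 7))
      exact (this.congr_right fun τ => by ring : _ =O[_] fun τ : ℂ => τ ^ 10).trans
        (hpow (by norm_num))
    refine ((((e1.add e2).add e3).add e4).sub (hdc p a)).congr' ?_ EventuallyEq.rfl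
    filter_upwards [hgc p a] with τ hτ
    simp only [Function.comp, hτ, J30]
    ring
  · intro q
    have := hline q 2 (by norm_num)
    simp [Finset.sum_range_succ] at this ⊢
    linear_combination this
  · intro q
    have := hline q 3 (by norm_num)
    have h2 : A * (q - p) = A * q + B := by linear_combination -hp
    rw [h2]
    simp [Finset.sum_range_succ] at this ⊢
    linear_combination this

/-- Taylor coefficients in two variables are unique. -/
theorem taylor_coeff_unique (d e : ℕ → ℕ → ℂ) (N : ℕ)
    (h : (fun v : ℂ × ℂ => (∑ k ∈ Finset.range N, ∑ j ∈ Finset.range (k + 1),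
        e k j * v.1 ^ j * v.2 ^ (k - j)) - ∑ k ∈ Finset.range N, ∑ j ∈ Finset.range (k + 1),
        d k j * v.1 ^ j * v.2 ^ (k - j)) =O[𝓝 0] fun v => ‖v‖ ^ N) (k j : ℕ) (hk : k < N)
    (hj : j ≤ k) : d k j = e k j := by
  have h1 : ∀ q : ℂ, ∑ j ∈ Finset.range (k + 1), (e k j - d k j) * q ^ j = 0 := by
    intro q
    have h2 := (h.comp_tendsto (parabola_tendsto_zero q 0)).trans (parabola_norm_pow_isBigO q 0 N)
    have h3 := curve_coeff_eq_zero (fun k j => e k j - d k j) N N q 0 (h2.congr_left fun τ => by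
      simp only [Function.comp, ← Finset.sum_sub_distrib, sub_mul]) k hk hk
    rw [Finset.sum_range_succ, Finset.sum_eq_zero, zero_add] at h3
    · simpa using h3
    · intro i hi
      have : k - i ≠ 0 := by have := Finset.mem_range.1 hi; omega
      simp [this]
  let P : Polynomial ℂ := ∑ j ∈ Finset.range (k + 1), Polynomial.C (e k j - d k j) *
    Polynomial.X ^ j
  have hP : P = 0 := Polynomial.funext fun q => by
    simpa [P, Polynomial.eval_finsetSum] using h1 q
  have h4 : P.coeff j = e k j - d k j := by
    simp only [P, Polynomial.finsetSum_coeff, Polynomial.coeff_C_mul_X_pow]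
    rw [Finset.sum_ite_eq, if_pos (by simp; omega)]
  rw [hP, Polynomial.coeff_zero] at h4
  exact (sub_eq_zero.1 h4.symm).symm

theorem exists_quadratic_jet (ψ : ℂ × ℂ → ℂ) (hψ : AnalyticAt ℂ ψ 0) (h0 : ψ 0 = 0)
    (h1 : fderiv ℂ ψ 0 ≠ 0) :
    ∃ A B q₀ q₁ q₂ : ℂ, (A ≠ 0 ∨ B ≠ 0) ∧
      (fun v : ℂ × ℂ => ψ v - (A * v.1 + B * v.2 + q₀ * v.1 ^ 2 + q₁ * v.1 * v.2
        + q₂ * v.2 ^ 2)) =O[𝓝 0] fun v => ‖v‖ ^ 3 := by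
  obtain ⟨c, -, hc⟩ := exists_taylor_coeff (E := ℂ) (fun w => ψ w.1)
    (AnalyticAt.comp (g := ψ) (f := Prod.fst) hψ analyticAt_fst) 3
  have hc := hc.self_of_nhds
  have h00 : c 0 0 0 = 0 := by
    have := hc.eq_zero_imp.self_of_nhds (by simp)
    simpa [Finset.sum_range_succ, h0, ← Prod.zero_eq_mk] using this
  have hO : (fun v : ℂ × ℂ => ψ v - (c 1 1 0 * v.1 + c 1 0 0 * v.2 + c 2 2 0 * v.1 ^ 2
      + c 2 1 0 * v.1 * v.2 + c 2 0 0 * v.2 ^ 2)) =O[𝓝 0] fun v => ‖v‖ ^ 3 := by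
    refine hc.congr_left fun v => ?_
    simp [Finset.sum_range_succ, h00]
    ring
  refine ⟨c 1 1 0, c 1 0 0, c 2 2 0, c 2 1 0, c 2 0 0, ?_, hO⟩
  by_contra! hAB
  rw [hAB.1, hAB.2] at hO
  refine h1 (HasFDerivAt.fderiv ?_)
  rw [hasFDerivAt_iff_isLittleO_nhds_zero]
  have hx : (fun v : ℂ × ℂ => v.1) =O[𝓝 0] fun v => ‖v‖ :=
    IsBigO.of_bound 1 (.of_forall fun v => by simpa using norm_fst_le v)
  have hy : (fun v : ℂ × ℂ => v.2) =O[𝓝 0] fun v => ‖v‖ :=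
    IsBigO.of_bound 1 (.of_forall fun v => by simpa using norm_snd_le v)
  have hlt : ∀ n : ℕ, 1 < n → (fun v : ℂ × ℂ => ‖v‖ ^ n) =o[𝓝 0] fun v => v := by
    intro n hn
    exact isLittleO_norm_pow_id hn
  have e1 := ((((hx.pow 2).const_mul_left (c 2 2 0)).add
    (((hx.mul hy).const_mul_left (c 2 1 0)).congr_right fun v => (sq ‖v‖).symm)).add
    ((hy.pow 2).const_mul_left (c 2 0 0))).trans_isLittleO (hlt 2 (by norm_num))
  refine ((hO.trans_isLittleO (hlt 3 (by norm_num))).add e1).congr_left fun v => ?_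
  simp [h0]
  ring

theorem RightEquiv.curve_equations {g : ℂ × ℂ → ℂ} {b c : ℂ} (h : RightEquiv g (J30 b c))
    (d : ℕ → ℕ → ℂ)
    (hd : (fun v : ℂ × ℂ => g v - ∑ k ∈ Finset.range 9, ∑ j ∈ Finset.range (k + 1),
        d k j * v.1 ^ j * v.2 ^ (k - j)) =O[𝓝 0] fun v => ‖v‖ ^ 9) :
    (∃ p a : ℂ, ‖p‖ ≤ 1 ∧
      ∀ n < 9, ∑ k ∈ Finset.range (n + 1), ∑ j ∈ Finset.range (k + 1),
        d k j * (j.choose (n - k) * p ^ (j - (n - k)) * a ^ (n - k)) = 0) ∨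
    ∃ p : ℂ, ‖p‖ ≤ 1 ∧ ∑ j ∈ Finset.range 5, d 4 (4 - j) * p ^ j = 0 := by
  obtain ⟨φ, hφ0, hφ, ⟨L, hL⟩, hg⟩ := h
  have hdφ := hφ.differentiableAt.hasFDerivAt
  have hψ : AnalyticAt ℂ (fun v => (φ v).1) 0 :=
    AnalyticAt.comp (g := Prod.fst) (f := φ) analyticAt_fst hφ
  have h1 : fderiv ℂ (fun v => (φ v).1) 0 ≠ 0 := by
    rw [hdφ.fst.fderiv, hL]
    intro h
    have := congrArg (fun M : ℂ × ℂ →L[ℂ] ℂ => M (L.symm (1, 0))) h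
    simp at this
  obtain ⟨A, B, q₀, q₁, q₂, hAB, hjet⟩ := exists_quadratic_jet _ hψ (by simp [hφ0]) h1
  have hχ : (fun v => (φ v).2) =O[𝓝 0] fun v : ℂ × ℂ => ‖v‖ := by
    have := hdφ.snd.isBigO_sub
    simp only [hφ0, Prod.snd_zero, sub_zero] at this
    exact this.norm_right
  rcases le_total ‖B‖ ‖A‖ with hle | hle
  · have hA : A ≠ 0 := by
      rintro rfl
      simp at hle hAB
      exact hAB hle
    obtain ⟨p, a, hp, heq, -⟩ :=
      J30_curve_equations g _ _ b c A B q₀ q₁ q₂ d hle hA hjet hχ hg hd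
    exact .inl ⟨p, a, hp, heq⟩
  · have hB : B ≠ 0 := by
      rintro rfl
      simp at hle hAB
      exact hAB hle
    have hswap : Tendsto (Prod.swap : ℂ × ℂ → ℂ × ℂ) (𝓝 0) (𝓝 0) := by
      simpa using (continuous_swap (X := ℂ) (Y := ℂ)).tendsto 0
    have hnorm : ∀ v : ℂ × ℂ, ‖v.swap‖ = ‖v‖ := fun v => by
      simp [Prod.norm_def, max_comm]
    obtain ⟨p, a, hp, heq, h2, h3⟩ := J30_curve_equations (fun v => g v.swap)
      (fun v => (φ v.swap).1) (fun v => (φ v.swap).2) b c B A q₂ q₁ q₀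
      (fun k j => d k (k - j)) hle hB
      ((hjet.comp_tendsto hswap).congr (fun v => by
        simp only [Function.comp, Prod.fst_swap, Prod.snd_swap]
        ring)
        fun v => by simp [hnorm])
      ((hχ.comp_tendsto hswap).congr_right fun v => by simp [hnorm])
      (hswap.eventually hg)
      ((hd.comp_tendsto hswap).congr (fun v => by
        simp only [Function.comp, Prod.fst_swap, Prod.snd_swap]
        congr 1
        refine Finset.sum_congr rfl fun k _ => ?_
        rw [← Finset.sum_range_reflect]
        refine Finset.sum_congr rfl fun j hj => ?_
        have hj := Finset.mem_range.1 hj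
        rw [show k + 1 - 1 - j = k - j by omega, show k - (k - j) = j by omega]
        ring) fun v => by simp [hnorm])
    refine .inr ⟨p, hp, ?_⟩
    have h4 := heq 4 (by norm_num)
    have h2a := h2 1
    have h2b := h2 0
    have h2c := h2 (-1)
    have h3a := h3 (p - 1)
    have h3b := h3 p
    have h3c := h3 (p + 1)
    have h3d := h3 (p + 2)
    simp [Finset.sum_range_succ, Nat.choose] at h4 h2a h2b h2c h3a h3b h3c h3d ⊢
    have hR : d 3 2 + 2 * d 3 1 * p + 3 * d 3 0 * p ^ 2 = 0 := by
      linear_combination (-2 * h3a - 3 * h3b + 6 * h3c - h3d) / 6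
    have h22 : d 2 0 = 0 := by linear_combination (h2a - 2 * h2b + h2c) / 2
    linear_combination h4 - a * hR - a ^ 2 * h22

/-- The coefficient of `x ^ j * y ^ (k - j)` in `x⁴ + s x² y³ + t x² y⁴ + y⁶`. -/
def W10Coeff (s t : ℂ) (k j : ℕ) : ℂ :=
  if k = 4 ∧ j = 4 then 1 else if k = 5 ∧ j = 2 then s else if k = 6 ∧ j = 2 then t else
    if k = 6 ∧ j = 0 then 1 else 0

theorem Ultrafilter.exists_tendsto_of_norm_le {ι : Type*} (U : Ultrafilter ι) (p : ι → ℂ) (R : ℝ)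
    (hp : ∀ᶠ i in U, ‖p i‖ ≤ R) : ∃ x, Tendsto p U (𝓝 x) := by
  obtain ⟨x, -, hx⟩ := (isCompact_closedBall (0 : ℂ) R).ultrafilter_le_nhds (U.map p)
    (le_principal_iff.2 (hp.mono fun i hi => by simpa using hi))
  exact ⟨x, hx⟩

theorem W10_no_curve {ι : Type*} (s t : ℂ) (U : Ultrafilter ι) (d : ℕ → ℕ → ι → ℂ)
    (hd : ∀ k j, k < 9 → j ≤ k → Tendsto (d k j) U (𝓝 (W10Coeff s t k j))) (p a : ι → ℂ)
    (hp : ∀ᶠ i in U, ‖p i‖ ≤ 1)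
    (heq : ∀ᶠ i in U, ∀ n < 9, ∑ k ∈ Finset.range (n + 1), ∑ j ∈ Finset.range (k + 1),
      d k j i * (j.choose (n - k) * p i ^ (j - (n - k)) * a i ^ (n - k)) = 0) : False := by
  obtain ⟨x, hx⟩ := U.exists_tendsto_of_norm_le p 1 hp
  by_cases hbdd : ∃ R, ∀ᶠ i in U, ‖a i‖ ≤ R
  · obtain ⟨R, hR⟩ := hbdd
    obtain ⟨y, hy⟩ := U.exists_tendsto_of_norm_le a R hR
    have hlim : ∀ n < 9, ∑ k ∈ Finset.range (n + 1), ∑ j ∈ Finset.range (k + 1),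
        W10Coeff s t k j * (j.choose (n - k) * x ^ (j - (n - k)) * y ^ (n - k)) = 0 := by
      intro n hn
      refine tendsto_nhds_unique (tendsto_finsetSum _ fun k hk => tendsto_finsetSum _ fun j hj =>
        (hd k j ?_ ?_).mul ((tendsto_const_nhds.mul (hx.pow _)).mul (hy.pow _)))
        (tendsto_const_nhds.congr' (heq.mono fun i hi => (hi n hn).symm))
      · have := Finset.mem_range.1 hk
        omega
      · have := Finset.mem_range.1 hj
        omega
    have h4 := hlim 4 (by norm_num)
    have h6 := hlim 6 (by norm_num)
    simp [Finset.sum_range_succ, W10Coeff] at h4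
    simp [Finset.sum_range_succ, W10Coeff, Nat.choose, h4] at h6
  · push Not at hbdd
    have ha : Tendsto (fun i => ‖a i‖) U atTop := by
      exact tendsto_atTop.2 fun R => (hbdd R).mono fun i hi => hi.le
    have he : Tendsto (fun i => (a i)⁻¹) U (𝓝 0) :=
      tendsto_inv₀_cobounded.comp (tendsto_norm_atTop_iff_cobounded.1 ha)
    have hne : ∀ᶠ i in U, a i ≠ 0 := by
      filter_upwards [ha.eventually_gt_atTop 0] with i hi
      exact norm_pos_iff.1 hi
    have h8 : ∀ᶠ i in U, ∑ k ∈ Finset.range 9, ∑ j ∈ Finset.range (k + 1),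
        d k j i * (j.choose (8 - k) * p i ^ (j - (8 - k)) * (a i)⁻¹ ^ (k - 4)) = 0 := by
      filter_upwards [heq, hne] with i hi hai
      have h := congrArg ((a i)⁻¹ ^ 4 * ·) (hi 8 (by norm_num))
      simp only [mul_zero, Finset.mul_sum] at h
      rw [← h]
      refine Finset.sum_congr rfl fun k hk => Finset.sum_congr rfl fun j hj => ?_
      have hk := Finset.mem_range.1 hk
      have hj := Finset.mem_range.1 hj
      by_cases hk4 : 4 ≤ k
      · have hpow : (a i)⁻¹ ^ 4 * a i ^ (8 - k) = (a i)⁻¹ ^ (k - 4) := by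
          have h4 : (a i)⁻¹ ^ 4 = (a i)⁻¹ ^ (k - 4) * (a i)⁻¹ ^ (8 - k) := by
            rw [← pow_add]
            congr 1
            omega
          rw [h4, mul_assoc, ← mul_pow, inv_mul_cancel₀ hai, one_pow, mul_one]
        rw [← hpow]
        ring
      · rw [Nat.choose_eq_zero_of_lt (by omega : j < 8 - k)]
        simp
    have hlim : ∑ k ∈ Finset.range 9, ∑ j ∈ Finset.range (k + 1),
        W10Coeff s t k j * (j.choose (8 - k) * x ^ (j - (8 - k)) * 0 ^ (k - 4)) = 0 := by
      refine tendsto_nhds_unique (tendsto_finsetSum _ fun k hk => tendsto_finsetSum _ fun j hj =>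
        (hd k j (Finset.mem_range.1 hk) ?_).mul ((tendsto_const_nhds.mul (hx.pow _)).mul
          (he.pow _))) (tendsto_const_nhds.congr' (h8.mono fun i hi => hi.symm))
      have := Finset.mem_range.1 hj
      omega
    simp [Finset.sum_range_succ, W10Coeff] at hlim

theorem W10_no_line {ι : Type*} (s t : ℂ) (U : Ultrafilter ι) (d : ℕ → ℕ → ι → ℂ)
    (hd : ∀ k j, k < 9 → j ≤ k → Tendsto (d k j) U (𝓝 (W10Coeff s t k j))) (p : ι → ℂ)
    (hp : ∀ᶠ i in U, ‖p i‖ ≤ 1)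
    (heq : ∀ᶠ i in U, ∑ j ∈ Finset.range 5, d 4 (4 - j) i * p i ^ j = 0) : False := by
  obtain ⟨x, hx⟩ := U.exists_tendsto_of_norm_le p 1 hp
  have hlim : ∑ j ∈ Finset.range 5, W10Coeff s t 4 (4 - j) * x ^ j = 0 :=
    tendsto_nhds_unique (tendsto_finsetSum _ fun j _ =>
      (hd 4 (4 - j) (by norm_num) (by omega)).mul (hx.pow j))
      (tendsto_const_nhds.congr' (heq.mono fun i hi => hi.symm))
  simp [Finset.sum_range_succ, W10Coeff] at hlim

theorem Filter.Frequently.exists_ultrafilter_le {ι : Type*} {l : Filter ι} {P : ι → Prop}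
    (h : ∃ᶠ i in l, P i) : ∃ U : Ultrafilter ι, ↑U ≤ l ∧ ∀ᶠ i in U, P i := by
  have := (frequently_mem_iff_neBot (s := {i | P i})).1 h
  have hU := Ultrafilter.of_le (l ⊓ 𝓟 {i | P i})
  exact ⟨_, hU.trans inf_le_left, le_principal_iff.1 (hU.trans inf_le_right)⟩

/-- The family W10 does not deform to `J_{3,0}`: for every analytic deformation
`F` of `f` with parameter in `ℂ^m` (m ≥ 1), all nearby nonzero parameter values
give germs not right equivalent to any member of `J_{3,0}`. -/
theorem not_deform_to_J30_W10 (s t : ℂ) (hs : s ^ 2 ≠ 4)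
    (m : ℕ) (hm : 1 ≤ m) (F : (ℂ × ℂ) × EuclideanSpace ℂ (Fin m) → ℂ)
    (hF : AnalyticAt ℂ F 0)
    (hF0 : ∀ᶠ p in nhds (0 : ℂ × ℂ), F (p, 0) = p.1 ^ 4 + s * p.1 ^ 2 * p.2 ^ 3 + t * p.1 ^ 2 * p.2 ^ 4 + p.2 ^ 6) :
    ∃ ε > (0 : ℝ), ∀ u : EuclideanSpace ℂ (Fin m), 0 < ‖u‖ → ‖u‖ < ε →
      ∀ b c : ℂ, 4 * b ^ 3 + 27 ≠ 0 →
        ¬ RightEquiv (fun p => F (p, u)) (J30 b c) := by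
  obtain ⟨d, hcont, hd⟩ := exists_taylor_coeff F hF 9
  have hd0 : ∀ k j, k < 9 → j ≤ k → d k j 0 = W10Coeff s t k j := by
    intro k j hk hj
    refine taylor_coeff_unique (fun k j => d k j 0) (W10Coeff s t) 9 ?_ k j hk hj
    refine hd.self_of_nhds.congr' ?_ EventuallyEq.rfl
    filter_upwards [hF0] with v hv
    rw [hv]
    congr 1
    simp [Finset.sum_range_succ, W10Coeff]
    ring
  have hlim : ∀ k j, k < 9 → j ≤ k → Tendsto (d k j) (𝓝 0) (𝓝 (W10Coeff s t k j)) :=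
    fun k j hk hj => hd0 k j hk hj ▸ (hcont k j).tendsto
  by_contra! hbad
  have hfreq : ∃ᶠ u in 𝓝 (0 : EuclideanSpace ℂ (Fin m)),
      ∃ b c, RightEquiv (fun p => F (p, u)) (J30 b c) := by
    refine Metric.nhds_basis_ball.frequently_iff.2 fun ε hε => ?_
    obtain ⟨u, -, hu, b, c, -, h⟩ := hbad ε hε
    exact ⟨u, by simpa using hu, b, c, h⟩
  have hfreq' := (hfreq.and_eventually hd).mono fun u ⟨⟨b, c, h⟩, hdu⟩ =>
    h.curve_equations (fun k j => d k j u) hdu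
  rcases frequently_or_distrib.1 hfreq' with h | h
  · obtain ⟨U, hU, hcurve⟩ := h.exists_ultrafilter_le
    obtain ⟨p, hcurve⟩ := hcurve.choice
    obtain ⟨a, hcurve⟩ := hcurve.choice
    exact W10_no_curve s t U d (fun k j hk hj => (hlim k j hk hj).mono_left hU) p a
      (hcurve.mono fun _ h => h.1) (hcurve.mono fun _ h => h.2)
  · obtain ⟨U, hU, hline⟩ := h.exists_ultrafilter_le
    obtain ⟨p, hline⟩ := hline.choice
    exact W10_no_line s t U d (fun k j hk hj => (hlim k j hk hj).mono_left hU) p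
      (hline.mono fun _ h => h.1) (hline.mono fun _ h => h.2)
end

section
/- Fix s ∈ ℂ with 4s³ + 27 ≠ 0 and define F : ℂ × ℂ² → ℂ by F(t,(x,y)) = x³y + s x²y³ + t x y⁶ + y⁷ (the family Z_{1,0}). Then F is Lipschitz trivial in t over ℂ: for every t₀ ∈ ℂ there exist a neighborhood T of t₀ in ℂ, a radius r > 0, a constant L ≥ 1, and a continuous map H : T × B(0,r) → ℂ² such that for each t ∈ T: H(t,0) = 0; L⁻¹‖p − q‖ ≤ ‖H(t,p) − H(t,q)‖ ≤ L‖p − q‖ for all p, q ∈ B(0,r); the image H(t, B(0,r)) is a neighborhood of 0 in ℂ²; and F(t, H(t,p)) = F(t₀, p) for all p ∈ B(0,r). -/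
open Filter

/-- The quasi-homogeneous gauge on `(t, x, y)`, where `x` has weight `2` and `y` has weight `1`. -/
noncomputable def weightedGauge (z : ℂ × (ℂ × ℂ)) : ℝ := max (√‖z.2.1‖) ‖z.2.2‖

lemma weightedGauge_nonneg (z : ℂ × (ℂ × ℂ)) : 0 ≤ weightedGauge z :=
  le_max_of_le_right (norm_nonneg _)

lemma norm_x_le_weightedGauge_sq (z : ℂ × (ℂ × ℂ)) : ‖z.2.1‖ ≤ weightedGauge z ^ 2 := by
  rw [← Real.sqrt_le_left (weightedGauge_nonneg z)]
  exact le_max_left _ _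

lemma norm_y_le_weightedGauge (z : ℂ × (ℂ × ℂ)) : ‖z.2.2‖ ≤ weightedGauge z :=
  le_max_right _ _

lemma weightedGauge_sq_le {z : ℂ × (ℂ × ℂ)} {δ : ℝ} (hδ : δ ≤ 1) (hz : ‖z.2‖ ≤ δ) :
    weightedGauge z ^ 2 ≤ δ := by
  have hx : ‖z.2.1‖ ≤ δ := (norm_fst_le z.2).trans hz
  have hy : ‖z.2.2‖ ≤ δ := (norm_snd_le z.2).trans hz
  unfold weightedGauge
  rcases max_choice (√‖z.2.1‖) ‖z.2.2‖ with h | h <;> rw [h]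
  · rwa [Real.sq_sqrt (norm_nonneg _)]
  · nlinarith [norm_nonneg z.2.2]

/-- The increment between `z` and `w`, measured quasi-homogeneously at the scale of `w`. -/
noncomputable def weightedIncr (z w : ℂ × (ℂ × ℂ)) : ℝ :=
  ‖z.2.1 - w.2.1‖ + weightedGauge w * ‖z.2.2 - w.2.2‖ + weightedGauge w ^ 2 * ‖z.1 - w.1‖

lemma weightedIncr_nonneg (z w : ℂ × (ℂ × ℂ)) : 0 ≤ weightedIncr z w := by
  have := weightedGauge_nonneg w
  unfold weightedIncr
  positivity

/-- `g` behaves on `S` like a quasi-homogeneous function of weight `k` that is smooth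
away from the axis `x = y = 0`. -/
def WeightedLipschitz (S : Set (ℂ × (ℂ × ℂ))) (k : ℕ) (g : ℂ × (ℂ × ℂ) → ℂ) : Prop :=
  ∃ C : ℝ, 0 ≤ C ∧ (∀ z ∈ S, ‖g z‖ ≤ C * weightedGauge z ^ k) ∧
    ∀ z ∈ S, ∀ w ∈ S, weightedGauge z ≤ weightedGauge w →
      weightedGauge w ^ 2 * ‖g z - g w‖ ≤ C * weightedGauge w ^ k * weightedIncr z w

namespace WeightedLipschitz

variable {S : Set (ℂ × (ℂ × ℂ))} {k l : ℕ} {g h : ℂ × (ℂ × ℂ) → ℂ}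

lemma const (c : ℂ) : WeightedLipschitz S 0 fun _ => c := by
  refine ⟨‖c‖, norm_nonneg _, fun z _ => by simp, fun z _ w _ _ => ?_⟩
  have := weightedIncr_nonneg z w
  simp only [sub_self, norm_zero, mul_zero]
  positivity

lemma x : WeightedLipschitz S 2 fun z => z.2.1 := by
  refine ⟨1, zero_le_one, fun z _ => by simpa using norm_x_le_weightedGauge_sq z,
    fun z _ w _ _ => ?_⟩
  have := weightedGauge_nonneg w
  rw [one_mul]
  gcongr
  unfold weightedIncr
  have : 0 ≤ weightedGauge w * ‖z.2.2 - w.2.2‖ := by positivity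
  have : 0 ≤ weightedGauge w ^ 2 * ‖z.1 - w.1‖ := by positivity
  linarith

lemma y : WeightedLipschitz S 1 fun z => z.2.2 := by
  refine ⟨1, zero_le_one, fun z _ => by simpa using norm_y_le_weightedGauge z,
    fun z _ w _ _ => ?_⟩
  have := weightedGauge_nonneg w
  rw [one_mul, pow_one, sq, mul_assoc]
  gcongr
  unfold weightedIncr
  have : 0 ≤ weightedGauge w ^ 2 * ‖z.1 - w.1‖ := by positivity
  linarith [norm_nonneg (z.2.1 - w.2.1)]

lemma t {M : ℝ} (hM : ∀ z ∈ S, ‖z.1‖ ≤ M) : WeightedLipschitz S 0 fun z => z.1 := by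
  refine ⟨max M 1, by positivity, fun z hz => by simpa using Or.inl (hM z hz),
    fun z _ w _ _ => ?_⟩
  have h1 := weightedGauge_nonneg w
  have h2 : weightedGauge w ^ 2 * ‖z.1 - w.1‖ ≤ weightedIncr z w := by
    unfold weightedIncr
    have : 0 ≤ weightedGauge w * ‖z.2.2 - w.2.2‖ := by positivity
    linarith [norm_nonneg (z.2.1 - w.2.1)]
  rw [pow_zero, mul_one]
  nlinarith [weightedIncr_nonneg z w, le_max_right M 1]

lemma mul (hg : WeightedLipschitz S k g) (hh : WeightedLipschitz S l h) :
    WeightedLipschitz S (k + l) fun z => g z * h z := by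
  obtain ⟨A, hA, hgA, hgA'⟩ := hg
  obtain ⟨B, hB, hhB, hhB'⟩ := hh
  refine ⟨2 * (A * B), by positivity, fun z hz => ?_, fun z hz w hw hzw => ?_⟩
  · have h0 := weightedGauge_nonneg z
    rw [norm_mul]
    calc ‖g z‖ * ‖h z‖ ≤ (A * weightedGauge z ^ k) * (B * weightedGauge z ^ l) := by
          gcongr
          exacts [hgA z hz, hhB z hz]
      _ = A * B * weightedGauge z ^ (k + l) := by ring
      _ ≤ _ := by
        refine mul_le_mul_of_nonneg_right ?_ (by positivity)
        linarith [mul_nonneg hA hB]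
  · have h0 := weightedGauge_nonneg z
    have h1 := weightedGauge_nonneg w
    have h2 := weightedIncr_nonneg z w
    have e : g z * h z - g w * h w = g z * (h z - h w) + (g z - g w) * h w := by ring
    have b1 : ‖g z‖ ≤ A * weightedGauge w ^ k := (hgA z hz).trans (by gcongr)
    calc weightedGauge w ^ 2 * ‖g z * h z - g w * h w‖
        ≤ weightedGauge w ^ 2 * (‖g z‖ * ‖h z - h w‖ + ‖g z - g w‖ * ‖h w‖) := by
          rw [e, ← norm_mul, ← norm_mul]
          gcongr
          exact norm_add_le _ _
      _ = ‖g z‖ * (weightedGauge w ^ 2 * ‖h z - h w‖)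
          + (weightedGauge w ^ 2 * ‖g z - g w‖) * ‖h w‖ := by ring
      _ ≤ (A * weightedGauge w ^ k) * (B * weightedGauge w ^ l * weightedIncr z w)
          + (A * weightedGauge w ^ k * weightedIncr z w) * (B * weightedGauge w ^ l) := by
          refine add_le_add (mul_le_mul b1 (hhB' z hz w hw hzw) (by positivity) (by positivity))
            (mul_le_mul (hgA' z hz w hw hzw) (hhB w hw) (by positivity) (by positivity))
      _ = _ := by ring

lemma pow (hg : WeightedLipschitz S k g) (n : ℕ) :
    WeightedLipschitz S (n * k) fun z => g z ^ n := by
  induction n with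
  | zero => simpa using const 1
  | succ n ih => simpa only [pow_succ, Nat.succ_mul] using ih.mul hg

lemma add (hg : WeightedLipschitz S k g) (hh : WeightedLipschitz S k h) :
    WeightedLipschitz S k fun z => g z + h z := by
  obtain ⟨A, hA, hgA, hgA'⟩ := hg
  obtain ⟨B, hB, hhB, hhB'⟩ := hh
  refine ⟨A + B, by positivity, fun z hz => ?_, fun z hz w hw hzw => ?_⟩
  · linarith [norm_add_le (g z) (h z), hgA z hz, hhB z hz]
  · have e : g z + h z - (g w + h w) = (g z - g w) + (h z - h w) := by ring
    have h3 := norm_add_le (g z - g w) (h z - h w)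
    rw [e]
    nlinarith [hgA' z hz w hw hzw, hhB' z hz w hw hzw,
      mul_le_mul_of_nonneg_left h3 (sq_nonneg (weightedGauge w))]

lemma conj (hg : WeightedLipschitz S k g) :
    WeightedLipschitz S k fun z => (starRingEnd ℂ) (g z) := by
  obtain ⟨A, hA, hgA, hgA'⟩ := hg
  refine ⟨A, hA, fun z hz => by simpa using hgA z hz, fun z hz w hw hzw => ?_⟩
  rw [← map_sub, RCLike.norm_conj]
  exact hgA' z hz w hw hzw

lemma of_le (hS : ∀ z ∈ S, weightedGauge z ≤ 1) (hlk : l ≤ k) (hg : WeightedLipschitz S k g) :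
    WeightedLipschitz S l g := by
  obtain ⟨A, hA, hgA, hgA'⟩ := hg
  refine ⟨A, hA, fun z hz => (hgA z hz).trans ?_,
    fun z hz w hw hzw => (hgA' z hz w hw hzw).trans ?_⟩
  · exact mul_le_mul_of_nonneg_left
      (pow_le_pow_of_le_one (weightedGauge_nonneg z) (hS z hz) hlk) hA
  · exact mul_le_mul_of_nonneg_right (mul_le_mul_of_nonneg_left
      (pow_le_pow_of_le_one (weightedGauge_nonneg w) (hS w hw) hlk) hA) (weightedIncr_nonneg z w)

lemma div (hg : WeightedLipschitz S (k + l) g) (hh : WeightedLipschitz S l h) {c : ℝ}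
    (hc : 0 < c) (hlow : ∀ z ∈ S, c * weightedGauge z ^ l ≤ ‖h z‖) (hk : k ≠ 0) :
    WeightedLipschitz S k fun z => g z / h z := by
  obtain ⟨A, hA, hgA, hgA'⟩ := hg
  obtain ⟨B, hB, hhB, hhB'⟩ := hh
  have bound : ∀ z ∈ S, ‖g z / h z‖ ≤ A / c * weightedGauge z ^ k := by
    intro z hz
    have h0 := weightedGauge_nonneg z
    rw [norm_div]
    apply div_le_of_le_mul₀ (norm_nonneg _) (by positivity)
    calc ‖g z‖ ≤ A * weightedGauge z ^ (k + l) := hgA z hz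
      _ = A / c * weightedGauge z ^ k * (c * weightedGauge z ^ l) := by
        field_simp
        ring
      _ ≤ _ := by
        gcongr
        exact hlow z hz
  refine ⟨A / c + A * B / c ^ 2, by positivity, fun z hz => (bound z hz).trans ?_,
    fun z hz w hw hzw => ?_⟩
  · have h0 := weightedGauge_nonneg z
    gcongr
    have : 0 ≤ A * B / c ^ 2 := by positivity
    linarith
  have h0 := weightedGauge_nonneg z
  have h2 := weightedIncr_nonneg z w
  rcases (weightedGauge_nonneg w).eq_or_lt with h1 | h1
  · simp [← h1, hk]
  set R := weightedGauge w
  have hRl : 0 < c * R ^ l := by positivity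
  have hw0 : h w ≠ 0 := norm_pos_iff.1 (hRl.trans_le (hlow w hw))
  have e : g z / h z - g w / h w = ((g z - g w) - g z / h z * (h z - h w)) / h w := by
    by_cases hz0 : h z = 0
    · have hgz : g z = 0 := by
        have h3 := hlow z hz
        rw [hz0, norm_zero] at h3
        have h4 : weightedGauge z ^ l = 0 :=
          le_antisymm (by by_contra! h; linarith [mul_pos hc h]) (by positivity)
        have h5 := hgA z hz
        rw [pow_add, h4] at h5
        simpa using h5
      simp [hz0, hgz, neg_div]
    · field_simp
      ring
  have b2 : ‖g z / h z‖ ≤ A / c * R ^ k := (bound z hz).trans (by gcongr)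
  rw [e, norm_div, ← mul_div_assoc]
  apply div_le_of_le_mul₀ (norm_nonneg _) (by positivity)
  calc R ^ 2 * ‖(g z - g w) - g z / h z * (h z - h w)‖
      ≤ R ^ 2 * (‖g z - g w‖ + ‖g z / h z‖ * ‖h z - h w‖) := by
        rw [← norm_mul]
        gcongr
        exact norm_sub_le _ _
    _ = R ^ 2 * ‖g z - g w‖ + ‖g z / h z‖ * (R ^ 2 * ‖h z - h w‖) := by ring
    _ ≤ A * R ^ (k + l) * weightedIncr z w
        + A / c * R ^ k * (B * R ^ l * weightedIncr z w) := by
        refine add_le_add (hgA' z hz w hw hzw)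
          (mul_le_mul b2 (hhB' z hz w hw hzw) (by positivity) (by positivity))
    _ = (A / c + A * B / c ^ 2) * R ^ k * weightedIncr z w * (c * R ^ l) := by
        field_simp
        ring
    _ ≤ _ := by
        gcongr
        exact hlow w hw

lemma eq_zero (hg : WeightedLipschitz S k g) (hk : k ≠ 0) {z : ℂ × (ℂ × ℂ)} (hz : z ∈ S)
    (hz0 : z.2 = 0) : g z = 0 := by
  obtain ⟨A, hA, hgA, -⟩ := hg
  simpa [weightedGauge, hz0, hk] using hgA z hz

lemma exists_lipschitzOnWith (hS : ∀ z ∈ S, weightedGauge z ≤ 1) (hg : WeightedLipschitz S 2 g) :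
    ∃ K, LipschitzOnWith K g S := by
  obtain ⟨A, hA, hgA, hgA'⟩ := hg
  have key : ∀ z ∈ S, ∀ w ∈ S, weightedGauge z ≤ weightedGauge w →
      ‖g z - g w‖ ≤ 3 * A * ‖z - w‖ := by
    intro z hz w hw hzw
    rcases (weightedGauge_nonneg w).eq_or_lt with h1 | h1
    · have h2 : weightedGauge z = 0 := le_antisymm (h1 ▸ hzw) (weightedGauge_nonneg z)
      have h3 := hgA z hz
      have h4 := hgA w hw
      rw [h2] at h3
      rw [← h1] at h4
      have h5 : g z = 0 := by simpa using h3
      have h6 : g w = 0 := by simpa using h4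
      rw [h5, h6, sub_zero, norm_zero]
      positivity
    · have h2 : ‖g z - g w‖ ≤ A * weightedIncr z w := by
        refine le_of_mul_le_mul_left ((hgA' z hz w hw hzw).trans_eq ?_) (pow_pos h1 2)
        ring
      have h3 : weightedIncr z w ≤ 3 * ‖z - w‖ := by
        have a1 : ‖z.1 - w.1‖ ≤ ‖z - w‖ := norm_fst_le (z - w)
        have a0 : ‖z.2 - w.2‖ ≤ ‖z - w‖ := norm_snd_le (z - w)
        have a2 : ‖z.2.1 - w.2.1‖ ≤ ‖z - w‖ := (norm_fst_le (z.2 - w.2)).trans a0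
        have a3 : ‖z.2.2 - w.2.2‖ ≤ ‖z - w‖ := (norm_snd_le (z.2 - w.2)).trans a0
        have a4 := hS w hw
        have a5 : weightedGauge w ^ 2 ≤ 1 := pow_le_one₀ h1.le a4
        unfold weightedIncr
        nlinarith [mul_le_of_le_one_left (norm_nonneg (z.2.2 - w.2.2)) a4,
          mul_le_of_le_one_left (norm_nonneg (z.1 - w.1)) a5]
      nlinarith
  refine ⟨⟨3 * A, by positivity⟩, LipschitzOnWith.of_dist_le_mul fun z hz w hw => ?_⟩
  rw [dist_eq_norm, dist_eq_norm]
  rcases le_total (weightedGauge z) (weightedGauge w) with h | h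
  · exact key z hz w hw h
  · rw [norm_sub_rev, norm_sub_rev z w]
    exact key w hw z hz h

end WeightedLipschitz


open Metric Set ODE in
/-- A local flow that is Lipschitz in the initial point and whose trajectories stay in the closed
ball on which the vector field is controlled. -/
theorem IsPicardLindelof.exists_lipschitzOnWith_flow_mem_closedBall {E : Type*}
    [NormedAddCommGroup E] [NormedSpace ℝ E] [CompleteSpace E] {f : ℝ → E → E} {tmin tmax : ℝ}
    {t₀ : Icc tmin tmax} {x₀ : E} {a r L K : NNReal} (hf : IsPicardLindelof f t₀ x₀ a r L K) :
    ∃ α : E → ℝ → E, (∀ x ∈ closedBall x₀ r, α x t₀ = x ∧ ∀ t ∈ Icc tmin tmax,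
      α x t ∈ closedBall x₀ a ∧ HasDerivWithinAt (α x) (f t (α x t)) (Icc tmin tmax) t) ∧
      ∃ L' : NNReal, ∀ t ∈ Icc tmin tmax, LipschitzOnWith L' (α · t) (closedBall x₀ r) := by
  classical
  have hsol (x) (hx : x ∈ closedBall x₀ r) := FunSpace.exists_isFixedPt_next hf hx
  choose β hβ using hsol
  obtain ⟨L', hL'⟩ := FunSpace.exists_forall_closedBall_funSpace_dist_le_mul hf
  refine ⟨fun x => if hx : x ∈ closedBall x₀ r then (β x hx).compProj else 0,
    fun x hx => ?_, L', fun t ht => LipschitzOnWith.of_dist_le_mul fun x hx y hy => ?_⟩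
  · simp only [dif_pos hx]
    refine ⟨?_, fun t ht => ⟨(β x hx).compProj_mem_closedBall hf.mul_max_le, ?_⟩⟩
    · rw [FunSpace.compProj_val, ← hβ x hx, FunSpace.next_apply₀]
    · refine (hasDerivWithinAt_picard_Icc t₀.2 hf.continuousOn_uncurry
        (β x hx).continuous_compProj.continuousOn
        (fun _ _ => (β x hx).compProj_mem_closedBall hf.mul_max_le) x ht).congr_of_mem
        (fun t' ht' => ?_) ht
      rw [FunSpace.compProj_of_mem ht']
      exact (FunSpace.isFixedPt_next_iff hf hx).1 (hβ x hx) ⟨t', ht'⟩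
  · simp only [dif_pos hx, dif_pos hy]
    exact ((β x hx).toContinuousMap.dist_apply_le_dist (g := (β y hy).toContinuousMap) _).trans
      (hL' x y hx hy _ _ (hβ x hx) (hβ y hy))

open Metric Set ODE in
/-- The flow of a Lipschitz vector field vanishing along `z = 0`, transported from time `t₀` to
nearby complex times `t₀ + c` along straight segments. -/
theorem exists_flow_of_lipschitzOnWith {E : Type*} [NormedAddCommGroup E] [NormedSpace ℝ E]
    [NormedSpace ℂ E] [IsScalarTower ℝ ℂ E] [CompleteSpace E] {V : ℂ × E → E} {t₀ : ℂ} {δ : ℝ}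
    (hδ : 0 < δ) {K : NNReal} (hV : LipschitzOnWith K V (closedBall (t₀, 0) δ))
    (hV0 : ∀ t, (t, (0 : E)) ∈ closedBall (t₀, (0 : E)) δ → V (t, 0) = 0) :
    ∃ ε : ℝ, 0 < ε ∧ ∃ γ : ℂ → E → ℝ → E,
      ContinuousOn (fun u : ℂ × E => γ u.1 u.2 1) (closedBall 0 ε) ∧
      ∀ c : ℂ, ‖c‖ ≤ ε → γ c 0 1 = 0 ∧
        (∀ p, ‖p‖ ≤ ε → γ c p 0 = p ∧ ∀ τ ∈ Icc (0 : ℝ) 1,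
          (t₀ + τ * c, γ c p τ) ∈ closedBall (t₀, (0 : E)) δ ∧
          HasDerivWithinAt (γ c p) (c • V (t₀ + τ * c, γ c p τ)) (Icc 0 1) τ) ∧
        ∀ p, ‖p‖ ≤ ε → ∀ q, ‖q‖ ≤ ε →
          ‖(γ c p 1 - γ c q 1) - (p - q)‖ ≤ 1 / 2 * ‖p - q‖ := by
  obtain ⟨a, ha, haδ, hKa⟩ : ∃ a : ℝ, 0 < a ∧ a ≤ δ ∧ K * a ≤ 1 / 2 := by
    refine ⟨min δ (1 / (2 * (K + 1))), by positivity, min_le_left _ _, ?_⟩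
    calc (K : ℝ) * min δ (1 / (2 * (K + 1))) ≤ (K + 1) * (1 / (2 * (K + 1))) := by
          gcongr
          · linarith
          · exact min_le_right _ _
      _ = 1 / 2 := by field_simp
  let f : ℝ → ℂ × E → ℂ × E := fun τ u => (0, u.1 • V (t₀ + τ * u.1, u.2))
  have hmem : ∀ τ ∈ Icc (0 : ℝ) 1, ∀ u ∈ closedBall (0 : ℂ × E) a,
      (t₀ + τ * u.1, u.2) ∈ closedBall (t₀, (0 : E)) a := by
    intro τ hτ u hu
    rw [mem_closedBall_zero_iff, Prod.norm_def, sup_le_iff] at hu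
    rw [mem_closedBall, Prod.dist_eq, sup_le_iff, dist_eq_norm, dist_zero_right]
    refine ⟨?_, hu.2⟩
    rw [add_sub_cancel_left, norm_mul, Complex.norm_real, Real.norm_of_nonneg hτ.1]
    nlinarith [norm_nonneg u.1, hτ.2, hu.1]
  have hsub : closedBall (t₀, (0 : E)) a ⊆ closedBall (t₀, (0 : E)) δ :=
    closedBall_subset_closedBall haδ
  have hVle : ∀ v ∈ closedBall (t₀, (0 : E)) a, ‖V v‖ ≤ 1 / 2 := by
    intro v hv
    have hv' := hv
    rw [mem_closedBall, Prod.dist_eq, sup_le_iff, dist_zero_right] at hv'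
    have hv0 : (v.1, (0 : E)) ∈ closedBall (t₀, (0 : E)) δ := by
      rw [mem_closedBall, Prod.dist_eq, sup_le_iff, dist_self]
      exact ⟨hv'.1.trans haδ, hδ.le⟩
    have h := hV.dist_le_mul v (hsub hv) _ hv0
    have h' : dist v (v.1, (0 : E)) = ‖v.2‖ := by simp [Prod.dist_eq]
    rw [hV0 _ hv0, dist_zero_right, h'] at h
    exact h.trans ((mul_le_mul_of_nonneg_left hv'.2 K.2).trans hKa)
  have hlip : ∀ τ ∈ Icc (0 : ℝ) 1, ∀ u ∈ closedBall (0 : ℂ × E) a,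
      ∀ v ∈ closedBall (0 : ℂ × E) a,
      ‖V (t₀ + τ * u.1, u.2) - V (t₀ + τ * v.1, v.2)‖ ≤ K * ‖u - v‖ := by
    intro τ hτ u hu v hv
    rw [← dist_eq_norm]
    refine (hV.dist_le_mul _ (hsub (hmem τ hτ u hu)) _ (hsub (hmem τ hτ v hv))).trans ?_
    gcongr
    rw [Prod.dist_eq, sup_le_iff, dist_eq_norm, dist_eq_norm]
    refine ⟨?_, norm_snd_le (u - v)⟩
    rw [add_sub_add_left_eq_sub, ← mul_sub, norm_mul, Complex.norm_real,
      Real.norm_of_nonneg hτ.1]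
    exact (mul_le_of_le_one_left (norm_nonneg _) hτ.2).trans (norm_fst_le (u - v))
  let a' : NNReal := ⟨a, ha.le⟩
  have hf : IsPicardLindelof f (⟨0, by simp⟩ : Icc (0 : ℝ) 1) (0 : ℂ × E) a' (a' / 2) (a' / 2) 1 :=
    { lipschitzOnWith := fun τ hτ => LipschitzOnWith.of_dist_le_mul fun u hu v hv => by
        rw [dist_eq_norm, dist_eq_norm]
        have hv1 : ‖v.1‖ ≤ a := (norm_fst_le v).trans (mem_closedBall_zero_iff.1 hv)
        have h1 := hVle _ (hmem τ hτ u hu)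
        have h2 := hlip τ hτ u hu v hv
        have h3 : ‖u.1 - v.1‖ ≤ ‖u - v‖ := norm_fst_le (u - v)
        have e : f τ u - f τ v = (0, (u.1 - v.1) • V (t₀ + τ * u.1, u.2)
            + v.1 • (V (t₀ + τ * u.1, u.2) - V (t₀ + τ * v.1, v.2))) := by
          simp only [f, Prod.mk_sub_mk, sub_self, Prod.mk.injEq, true_and]
          module
        rw [e, Prod.norm_mk, norm_zero, max_eq_right (norm_nonneg _), NNReal.coe_one, one_mul]
        refine (norm_add_le _ _).trans ?_
        rw [norm_smul, norm_smul]
        calc _ ≤ ‖u - v‖ * (1 / 2) + a * (K * ‖u - v‖) := by gcongr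
          _ = ‖u - v‖ * (1 / 2) + K * a * ‖u - v‖ := by ring
          _ ≤ ‖u - v‖ * (1 / 2) + 1 / 2 * ‖u - v‖ := by gcongr
          _ = ‖u - v‖ := by ring
      continuousOn := fun u hu => by
        refine continuousOn_const.prodMk (continuousOn_const.smul ?_)
        exact hV.continuousOn.comp (by fun_prop) fun τ hτ => hsub (hmem τ hτ u hu)
      norm_le := fun τ hτ u hu => by
        have hu1 : ‖u.1‖ ≤ a := (norm_fst_le u).trans (mem_closedBall_zero_iff.1 hu)
        have h1 := hVle _ (hmem τ hτ u hu)
        rw [Prod.norm_mk, norm_zero, max_eq_right (norm_nonneg _), norm_smul]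
        calc _ ≤ a * (1 / 2) := by gcongr
          _ = a / 2 := by ring
      mul_max_le := by
        have h2 : ((a' / 2 : NNReal) : ℝ) = a / 2 := rfl
        have h1 : (a' : ℝ) = a := rfl
        rw [h1, h2]
        norm_num
        linarith }
  obtain ⟨α, hα, L, hL⟩ := hf.exists_lipschitzOnWith_flow_mem_closedBall
  have h01 : (0 : ℝ) ∈ Icc (0 : ℝ) 1 := left_mem_Icc.2 zero_le_one
  have h11 : (1 : ℝ) ∈ Icc (0 : ℝ) 1 := right_mem_Icc.2 zero_le_one
  have ha' : ((a' / 2 : NNReal) : ℝ) = a / 2 := rfl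
  rw [ha'] at hα hL
  have hfst : ∀ u ∈ closedBall (0 : ℂ × E) (a / 2), ∀ τ ∈ Icc (0 : ℝ) 1, (α u τ).1 = u.1 := by
    intro u hu τ hτ
    have h := (convex_Icc (0 : ℝ) 1).norm_image_sub_le_of_norm_hasDerivWithin_le
      (f := fun σ => (α u σ).1) (f' := fun _ => 0) (C := 0)
      (fun σ hσ => ((hα u hu).2 σ hσ).2.fst) (by simp) h01 hτ
    rw [zero_mul, norm_le_zero_iff, sub_eq_zero] at h
    rw [h]
    exact congrArg Prod.fst (hα u hu).1
  obtain ⟨ε, hε, hεa, hεL⟩ : ∃ ε : ℝ, 0 < ε ∧ ε ≤ a / 2 ∧ ε * (K * L) ≤ 1 / 2 := by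
    refine ⟨min (a / 2) (1 / (2 * (K * L + 1))), by positivity, min_le_left _ _, ?_⟩
    calc min (a / 2) (1 / (2 * (K * L + 1))) * ((K : ℝ) * L)
        ≤ (1 / (2 * (K * L + 1))) * (K * L + 1) := by
          gcongr
          · exact min_le_right _ _
          · linarith
      _ = 1 / 2 := by field_simp
  have hmk : ∀ c : ℂ, ‖c‖ ≤ ε → ∀ p : E, ‖p‖ ≤ ε → (c, p) ∈ closedBall (0 : ℂ × E) (a / 2) := by
    intro c hc p hp
    rw [mem_closedBall_zero_iff, Prod.norm_mk, max_le_iff]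
    exact ⟨hc.trans hεa, hp.trans hεa⟩
  have hsnd : ∀ c : ℂ, ‖c‖ ≤ ε → ∀ p : E, ‖p‖ ≤ ε → ∀ τ ∈ Icc (0 : ℝ) 1,
      HasDerivWithinAt (fun σ => (α (c, p) σ).2) (c • V (t₀ + τ * c, (α (c, p) τ).2))
        (Icc 0 1) τ := by
    intro c hc p hp τ hτ
    have h := ((hα _ (hmk c hc p hp)).2 τ hτ).2.hasFDerivWithinAt.snd.hasDerivWithinAt
    simpa [f, hfst _ (hmk c hc p hp) τ hτ] using h
  refine ⟨ε, hε, fun c p τ => (α (c, p) τ).2, ?_, fun c hc => ⟨?_, fun p hp => ⟨?_, ?_⟩, ?_⟩⟩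
  · exact continuous_snd.comp_continuousOn
      ((hL 1 h11).continuousOn.mono (closedBall_subset_closedBall hεa))
  · have h0 := hmk c hc 0 (by simpa using hε.le)
    have hc0 : (c, (0 : E)) ∈ closedBall (0 : ℂ × E) a :=
      closedBall_subset_closedBall (by linarith) h0
    have h := ODE_solution_unique_of_mem_Icc_right (v := f) (s := fun _ => closedBall 0 a) (K := 1)
      (f := α (c, 0)) (g := fun _ => (c, 0)) (a := 0) (b := 1)
      (fun t ht => hf.lipschitzOnWith t (Ico_subset_Icc_self ht))
      (HasDerivWithinAt.continuousOn fun τ hτ => ((hα _ h0).2 τ hτ).2)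
      (fun τ hτ => ((hα _ h0).2 τ (Ico_subset_Icc_self hτ)).2.mono_of_mem_nhdsWithin
        (Icc_mem_nhdsGE_of_mem hτ))
      (fun τ hτ => ((hα _ h0).2 τ (Ico_subset_Icc_self hτ)).1)
      continuousOn_const
      (fun τ hτ => by
        have e : f τ (c, 0) = 0 := by
          simp [f, hV0 _ (hsub (hmem τ (Ico_subset_Icc_self hτ) _ hc0))]
        rw [e]
        exact hasDerivWithinAt_const _ _ _)
      (fun _ _ => hc0) (hα _ h0).1
    exact congrArg Prod.snd (h h11)
  · exact congrArg Prod.snd (hα _ (hmk c hc p hp)).1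
  · intro τ hτ
    refine ⟨?_, hsnd c hc p hp τ hτ⟩
    have h := hmem τ hτ _ ((hα _ (hmk c hc p hp)).2 τ hτ).1
    rw [hfst _ (hmk c hc p hp) τ hτ] at h
    exact hsub h
  · intro p hp q hq
    have hP := hmk c hc p hp
    have hQ := hmk c hc q hq
    have h := norm_image_sub_le_of_norm_deriv_le_segment_01' (C := 1 / 2 * ‖p - q‖)
      (fun τ hτ => (hsnd c hc p hp τ hτ).sub (hsnd c hc q hq τ hτ)) fun τ hτ => by
        have hτ' := Ico_subset_Icc_self hτ
        have h1 := hlip τ hτ' _ ((hα _ hP).2 τ hτ').1 _ ((hα _ hQ).2 τ hτ').1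
        have h2 := (hL τ hτ').dist_le_mul _ hP _ hQ
        have h3 : dist (c, p) (c, q) = ‖p - q‖ := by simp [dist_eq_norm]
        rw [h3, dist_eq_norm] at h2
        rw [hfst _ hP τ hτ', hfst _ hQ τ hτ'] at h1
        rw [← smul_sub, norm_smul]
        calc _ ≤ ε * (K * (L * ‖p - q‖)) := by
              gcongr
              exact h1.trans (by gcongr)
          _ = ε * (K * L) * ‖p - q‖ := by ring
          _ ≤ 1 / 2 * ‖p - q‖ := by gcongr
    simpa only [Pi.sub_apply, (hα _ hP).1, (hα _ hQ).1] using h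

lemma Z10_gradient_eq_zero {s : ℂ} (hs : 4 * s ^ 3 + 27 ≠ 0) {x y : ℂ}
    (h1 : y * (3 * x ^ 2 * y + 2 * s * x * y ^ 3) = 0)
    (h2 : x ^ 3 + 3 * s * x ^ 2 * y ^ 2 + 7 * y ^ 6 = 0) : x = 0 ∧ y = 0 := by
  by_cases hy : y = 0
  · subst hy
    exact ⟨by simpa using h2, rfl⟩
  exfalso
  have h3 : x * (3 * x + 2 * s * y ^ 2) = 0 := by
    have : y ^ 2 * (x * (3 * x + 2 * s * y ^ 2)) = 0 := by linear_combination h1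
    exact (mul_eq_zero.1 this).resolve_left (pow_ne_zero 2 hy)
  rcases mul_eq_zero.1 h3 with h | h
  · subst h
    simp [hy] at h2
  · have hx : x = -(2 * s * y ^ 2) / 3 := by linear_combination h / 3
    have : 7 / 27 * (4 * s ^ 3 + 27) * y ^ 6 = 0 := by
      rw [← h2, hx]
      ring
    simp [hs, hy] at this

/-- The gradient of the quasi-homogeneous part of the family is bounded below by the gauge. -/
lemma exists_le_Z10_gradient {s : ℂ} (hs : 4 * s ^ 3 + 27 ≠ 0) :
    ∃ c : ℝ, 0 < c ∧ ∀ z : ℂ × (ℂ × ℂ), c * weightedGauge z ^ 12 ≤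
      ‖z.2.2 * (3 * z.2.1 ^ 2 * z.2.2 + 2 * s * z.2.1 * z.2.2 ^ 3)‖ ^ 2
        + ‖z.2.1 ^ 3 + 3 * s * z.2.1 ^ 2 * z.2.2 ^ 2 + 7 * z.2.2 ^ 6‖ ^ 2 := by
  let N : ℂ × ℂ → ℝ := fun p => ‖p.2 * (3 * p.1 ^ 2 * p.2 + 2 * s * p.1 * p.2 ^ 3)‖ ^ 2
        + ‖p.1 ^ 3 + 3 * s * p.1 ^ 2 * p.2 ^ 2 + 7 * p.2 ^ 6‖ ^ 2
  let G : ℂ × ℂ → ℝ := fun p => max (√‖p.1‖) ‖p.2‖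
  have hG : Continuous G := by fun_prop
  have hK : IsCompact {p | G p = 1} := by
    refine Metric.isCompact_of_isClosed_isBounded (isClosed_eq hG continuous_const)
      (Metric.isBounded_closedBall (x := 0) (r := 1) |>.subset fun p hp => ?_)
    have hp' : max (√‖p.1‖) ‖p.2‖ ≤ 1 := le_of_eq hp
    rw [max_le_iff, Real.sqrt_le_one] at hp'
    simpa [Prod.norm_def] using hp'
  have hne : {p | G p = 1}.Nonempty := ⟨(1, 1), by simp [G]⟩
  obtain ⟨p₀, hp₀, hmin⟩ := hK.exists_isMinOn hne (f := N) (by fun_prop)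
  refine ⟨N p₀, ?_, fun z => ?_⟩
  · have h0 : 0 ≤ N p₀ := by positivity
    refine h0.lt_of_ne' fun h => ?_
    obtain ⟨h1, h2⟩ := (add_eq_zero_iff_of_nonneg (by positivity) (by positivity)).1 h
    rw [sq_eq_zero_iff, norm_eq_zero] at h1 h2
    obtain ⟨hx, hy⟩ := Z10_gradient_eq_zero hs h1 h2
    have hp₀' : max (√‖p₀.1‖) ‖p₀.2‖ = 1 := hp₀
    simp [hx, hy] at hp₀'
  · have hnn : 0 ≤ weightedGauge z := le_max_of_le_right (norm_nonneg _)
    rcases hnn.eq_or_lt with h | h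
    · rw [← h]
      simp only [ne_eq, OfNat.ofNat_ne_zero, not_false_eq_true, zero_pow, mul_zero]
      positivity
    · set R := weightedGauge z with hR
      have hRC : (R : ℂ) ≠ 0 := by exact_mod_cast h.ne'
      have hmem : ((z.2.1 / R ^ 2, z.2.2 / R) : ℂ × ℂ) ∈ {p | G p = 1} := by
        have : √‖z.2.1 / (R : ℂ) ^ 2‖ = √‖z.2.1‖ / R := by
          rw [norm_div, norm_pow, Complex.norm_real, Real.norm_of_nonneg hnn,
            Real.sqrt_div (norm_nonneg _), Real.sqrt_sq hnn]
        change max (√‖z.2.1 / (R : ℂ) ^ 2‖) ‖z.2.2 / (R : ℂ)‖ = 1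
        rw [this, norm_div, Complex.norm_real, Real.norm_of_nonneg hnn,
          max_div_div_right hnn]
        exact div_self h.ne'
      have hle : N p₀ ≤ N (z.2.1 / R ^ 2, z.2.2 / R) := hmin hmem
      have e1 : z.2.2 / R * (3 * (z.2.1 / R ^ 2) ^ 2 * (z.2.2 / R)
          + 2 * s * (z.2.1 / R ^ 2) * (z.2.2 / R) ^ 3)
          = z.2.2 * (3 * z.2.1 ^ 2 * z.2.2 + 2 * s * z.2.1 * z.2.2 ^ 3) / (R : ℂ) ^ 6 := by
        field_simp
      have e2 : (z.2.1 / R ^ 2) ^ 3 + 3 * s * (z.2.1 / R ^ 2) ^ 2 * (z.2.2 / R) ^ 2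
          + 7 * (z.2.2 / R) ^ 6
          = (z.2.1 ^ 3 + 3 * s * z.2.1 ^ 2 * z.2.2 ^ 2 + 7 * z.2.2 ^ 6) / (R : ℂ) ^ 6 := by
        field_simp
      simp only [N, e1, e2] at hle ⊢
      rw [norm_div, norm_div, norm_pow (R : ℂ), Complex.norm_real, Real.norm_of_nonneg hnn,
        div_pow, div_pow, ← add_div, ← pow_mul, le_div_iff₀ (by positivity)] at hle
      exact hle

/-- Adding the term `t x y⁶` does not destroy the lower bound on the gradient close to the axis. -/
lemma exists_le_Z10_perturbed_gradient {s : ℂ} (hs : 4 * s ^ 3 + 27 ≠ 0) (M : ℝ) :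
    ∃ c δ : ℝ, 0 < c ∧ 0 < δ ∧ δ ≤ 1 ∧ ∀ z : ℂ × (ℂ × ℂ), ‖z.1‖ ≤ M → ‖z.2‖ ≤ δ →
      c * weightedGauge z ^ 12 ≤
        ‖z.2.2 * (3 * z.2.1 ^ 2 * z.2.2 + 2 * s * z.2.1 * z.2.2 ^ 3 + z.1 * z.2.2 ^ 6)‖ ^ 2
        + ‖z.2.1 ^ 3 + 3 * s * z.2.1 ^ 2 * z.2.2 ^ 2 + 6 * z.1 * z.2.1 * z.2.2 ^ 5
          + 7 * z.2.2 ^ 6‖ ^ 2 := by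
  obtain ⟨c, hc, hlow⟩ := exists_le_Z10_gradient hs
  have half_sq_le : ∀ u v : ℂ, ‖u‖ ^ 2 / 2 - ‖v‖ ^ 2 ≤ ‖u + v‖ ^ 2 := fun u v => by
    have h : ‖u‖ ≤ ‖u + v‖ + ‖v‖ := by simpa using norm_sub_le (u + v) v
    nlinarith [norm_nonneg u, norm_nonneg v, norm_nonneg (u + v), sq_nonneg (‖u + v‖ - ‖v‖)]
  refine ⟨c / 4, min 1 (c / (4 * (37 * M ^ 2 + 1))), by positivity, by positivity,
    min_le_left _ _, fun z hzM hz => ?_⟩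
  set R := weightedGauge z with hR
  have hR0 : 0 ≤ R := weightedGauge_nonneg z
  have hR2 : R ^ 2 ≤ c / (4 * (37 * M ^ 2 + 1)) :=
    (weightedGauge_sq_le (min_le_left _ _) hz).trans (min_le_right _ _)
  have hR2' : 37 * M ^ 2 * R ^ 2 ≤ c / 4 := by
    calc 37 * M ^ 2 * R ^ 2 ≤ (37 * M ^ 2 + 1) * (c / (4 * (37 * M ^ 2 + 1))) := by
          gcongr
          linarith
      _ = c / 4 := by field_simp
  have hx := norm_x_le_weightedGauge_sq z
  have hy := norm_y_le_weightedGauge z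
  rw [← hR] at hx hy
  have hM : 0 ≤ M := (norm_nonneg _).trans hzM
  have p1 : ‖z.1 * z.2.2 ^ 7‖ ≤ M * R ^ 7 := by
    rw [norm_mul, norm_pow]
    gcongr
  have p2 : ‖6 * z.1 * z.2.1 * z.2.2 ^ 5‖ ≤ 6 * M * R ^ 7 := by
    rw [norm_mul, norm_mul, norm_mul, norm_pow, RCLike.norm_ofNat]
    calc 6 * ‖z.1‖ * ‖z.2.1‖ * ‖z.2.2‖ ^ 5 ≤ 6 * M * R ^ 2 * R ^ 5 := by gcongr
      _ = _ := by ring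
  have q1 := half_sq_le (z.2.2 * (3 * z.2.1 ^ 2 * z.2.2 + 2 * s * z.2.1 * z.2.2 ^ 3))
    (z.1 * z.2.2 ^ 7)
  have q2 := half_sq_le (z.2.1 ^ 3 + 3 * s * z.2.1 ^ 2 * z.2.2 ^ 2 + 7 * z.2.2 ^ 6)
    (6 * z.1 * z.2.1 * z.2.2 ^ 5)
  have e1 : z.2.2 * (3 * z.2.1 ^ 2 * z.2.2 + 2 * s * z.2.1 * z.2.2 ^ 3 + z.1 * z.2.2 ^ 6)
      = z.2.2 * (3 * z.2.1 ^ 2 * z.2.2 + 2 * s * z.2.1 * z.2.2 ^ 3) + z.1 * z.2.2 ^ 7 := by ring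
  have e2 : z.2.1 ^ 3 + 3 * s * z.2.1 ^ 2 * z.2.2 ^ 2 + 6 * z.1 * z.2.1 * z.2.2 ^ 5
        + 7 * z.2.2 ^ 6
      = z.2.1 ^ 3 + 3 * s * z.2.1 ^ 2 * z.2.2 ^ 2 + 7 * z.2.2 ^ 6
        + 6 * z.1 * z.2.1 * z.2.2 ^ 5 := by ring
  rw [e1, e2]
  have s1 := pow_le_pow_left₀ (norm_nonneg _) p1 2
  have s2 := pow_le_pow_left₀ (norm_nonneg _) p2 2
  have s3 : 37 * M ^ 2 * R ^ 2 * R ^ 12 ≤ c / 4 * R ^ 12 := by gcongr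
  have s4 := hlow z
  have s5 : (M * R ^ 7) ^ 2 + (6 * M * R ^ 7) ^ 2 = 37 * M ^ 2 * R ^ 2 * R ^ 12 := by ring
  rw [← hR] at s4
  linarith

/-- The vector field trivializing the family: a Lipschitz lift of `∂/∂t` along `F`. -/
lemma exists_lipschitz_lift_Z10 {s : ℂ} (hs : 4 * s ^ 3 + 27 ≠ 0) (t₀ : ℂ) :
    ∃ δ : ℝ, 0 < δ ∧ ∃ (K : NNReal) (V : ℂ × (ℂ × ℂ) → ℂ × ℂ),
      LipschitzOnWith K V (Metric.closedBall (t₀, 0) δ) ∧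
      (∀ t, (t, (0 : ℂ × ℂ)) ∈ Metric.closedBall (t₀, (0 : ℂ × ℂ)) δ → V (t, 0) = 0) ∧
      ∀ z ∈ Metric.closedBall (t₀, (0 : ℂ × ℂ)) δ,
        z.2.1 * z.2.2 ^ 6
        + (3 * z.2.1 ^ 2 * z.2.2 + 2 * s * z.2.1 * z.2.2 ^ 3 + z.1 * z.2.2 ^ 6) * (V z).1
        + (z.2.1 ^ 3 + 3 * s * z.2.1 ^ 2 * z.2.2 ^ 2 + 6 * z.1 * z.2.1 * z.2.2 ^ 5
          + 7 * z.2.2 ^ 6) * (V z).2 = 0 := by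
  obtain ⟨c, δ, hc, hδ, hδ1, hlow⟩ := exists_le_Z10_perturbed_gradient hs (‖t₀‖ + 1)
  set S := Metric.closedBall (t₀, (0 : ℂ × ℂ)) δ with hS
  have hS2 : ∀ z ∈ S, ‖z.2‖ ≤ δ := fun z hz => by
    rw [hS, Metric.mem_closedBall, Prod.dist_eq, sup_le_iff, dist_zero_right] at hz
    exact hz.2
  have hS1 : ∀ z ∈ S, ‖z.1‖ ≤ ‖t₀‖ + 1 := fun z hz => by
    rw [hS, Metric.mem_closedBall, Prod.dist_eq, sup_le_iff, dist_eq_norm] at hz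
    have := norm_sub_norm_le z.1 t₀
    linarith [hz.1]
  have hg1 : ∀ z ∈ S, weightedGauge z ≤ 1 := fun z hz => by
    have := (weightedGauge_sq_le hδ1 (hS2 z hz)).trans hδ1
    exact (sq_le_one_iff₀ (weightedGauge_nonneg z)).1 this
  let Fx : ℂ × (ℂ × ℂ) → ℂ := fun z =>
    3 * z.2.1 ^ 2 * z.2.2 + 2 * s * z.2.1 * z.2.2 ^ 3 + z.1 * z.2.2 ^ 6
  let Fy : ℂ × (ℂ × ℂ) → ℂ := fun z =>
    z.2.1 ^ 3 + 3 * s * z.2.1 ^ 2 * z.2.2 ^ 2 + 6 * z.1 * z.2.1 * z.2.2 ^ 5 + 7 * z.2.2 ^ 6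
  let D : ℂ × (ℂ × ℂ) → ℂ := fun z => z.2.2 * Fx z * (starRingEnd ℂ) (z.2.2 * Fx z)
    + Fy z * (starRingEnd ℂ) (Fy z)
  have hx : WeightedLipschitz S 2 fun z => z.2.1 := .x
  have hy : WeightedLipschitz S 1 fun z => z.2.2 := .y
  have ht : WeightedLipschitz S 0 fun z => z.1 := .t hS1
  have hk (a : ℂ) : WeightedLipschitz S 0 fun _ => a := .const a
  have hFx : WeightedLipschitz S 5 Fx :=
    ((((hk 3).mul (hx.pow 2)).mul hy).add (((hk (2 * s)).mul hx).mul (hy.pow 3))).add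
      ((ht.mul (hy.pow 6)).of_le hg1 (by norm_num))
  have hFy : WeightedLipschitz S 6 Fy :=
    (((hx.pow 3).add (((hk (3 * s)).mul (hx.pow 2)).mul (hy.pow 2))).add
      (((((hk 6).mul ht).mul hx).mul (hy.pow 5)).of_le hg1 (by norm_num))).add
      ((hk 7).mul (hy.pow 6))
  have hyFx : WeightedLipschitz S 6 fun z => z.2.2 * Fx z := hy.mul hFx
  have hD : WeightedLipschitz S 12 D := (hyFx.mul hyFx.conj).add (hFy.mul hFy.conj)
  have hDlow : ∀ z ∈ S, c * weightedGauge z ^ 12 ≤ ‖D z‖ := fun z hz => by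
    have e : D z = ((‖z.2.2 * Fx z‖ ^ 2 + ‖Fy z‖ ^ 2 : ℝ) : ℂ) := by
      simp only [D, RCLike.mul_conj]
      push_cast
      rfl
    rw [e, Complex.norm_real, Real.norm_of_nonneg (by positivity)]
    exact hlow z (hS1 z hz) (hS2 z hz)
  have hxy : WeightedLipschitz S 8 fun z => -(z.2.1 * z.2.2 ^ 6) := by
    simpa only [neg_one_mul] using (hk (-1)).mul (hx.mul (hy.pow 6))
  have hV1 : WeightedLipschitz S 2 fun z =>
      -(z.2.1 * z.2.2 ^ 6) * (z.2.2 * (starRingEnd ℂ) (z.2.2 * Fx z)) / D z :=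
    ((hxy.mul (hy.mul hyFx.conj)).of_le hg1 (by norm_num)).div hD hc hDlow two_ne_zero
  have hV2 : WeightedLipschitz S 2 fun z =>
      -(z.2.1 * z.2.2 ^ 6) * (starRingEnd ℂ) (Fy z) / D z :=
    WeightedLipschitz.div (k := 2) (l := 12) (hxy.mul hFy.conj) hD hc hDlow two_ne_zero
  obtain ⟨K₁, hK₁⟩ := hV1.exists_lipschitzOnWith hg1
  obtain ⟨K₂, hK₂⟩ := hV2.exists_lipschitzOnWith hg1
  refine ⟨δ, hδ, max K₁ K₂, fun z =>
    (-(z.2.1 * z.2.2 ^ 6) * (z.2.2 * (starRingEnd ℂ) (z.2.2 * Fx z)) / D z,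
      -(z.2.1 * z.2.2 ^ 6) * (starRingEnd ℂ) (Fy z) / D z), hK₁.prodMk hK₂,
    fun t htS => Prod.ext (hV1.eq_zero two_ne_zero htS rfl) (hV2.eq_zero two_ne_zero htS rfl),
    fun z hz => ?_⟩
  change z.2.1 * z.2.2 ^ 6
    + Fx z * (-(z.2.1 * z.2.2 ^ 6) * (z.2.2 * (starRingEnd ℂ) (z.2.2 * Fx z)) / D z)
    + Fy z * (-(z.2.1 * z.2.2 ^ 6) * (starRingEnd ℂ) (Fy z) / D z) = 0
  by_cases h0 : D z = 0
  · have h1 := hDlow z hz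
    have hg := weightedGauge_nonneg z
    rw [h0, norm_zero] at h1
    have h2 : weightedGauge z = 0 := by
      by_contra h
      have : 0 < c * weightedGauge z ^ 12 := by positivity
      linarith
    have h3 : z.2.2 = 0 := by simpa [h2] using norm_y_le_weightedGauge z
    simp [h0, h3]
  · field_simp
    simp only [D]
    ring

/-- The family Z10, `F t = fun (x,y) => w.1 ^ 3 * w.2 + s * w.1 ^ 2 * w.2 ^ 3 + τ * w.1 * w.2 ^ 6 + w.2 ^ 7`, is Lipschitz trivial in `t` over `ℂ`:
for every `t₀` there are a neighborhood `T` of `t₀`, `r > 0`, `L ≥ 1`, and a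
continuous family `H` of bi-Lipschitz homeomorphisms with `F t ∘ H t = F t₀` on
`B(0,r)`. -/
theorem lipschitz_trivial_Z10 (s : ℂ) (hs : 4 * s ^ 3 + 27 ≠ 0) (t₀ : ℂ) :
    ∃ T ∈ nhds t₀, ∃ r L : ℝ, 0 < r ∧ 1 ≤ L ∧
      ∃ H : ℂ × (ℂ × ℂ) → ℂ × ℂ,
        ContinuousOn H (T ×ˢ Metric.ball (0 : ℂ × ℂ) r) ∧
        ∀ t ∈ T,
          H (t, 0) = 0 ∧
          (∀ p ∈ Metric.ball (0 : ℂ × ℂ) r, ∀ q ∈ Metric.ball (0 : ℂ × ℂ) r,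
            L⁻¹ * ‖p - q‖ ≤ ‖H (t, p) - H (t, q)‖ ∧
            ‖H (t, p) - H (t, q)‖ ≤ L * ‖p - q‖) ∧
          ((fun p => H (t, p)) '' Metric.ball (0 : ℂ × ℂ) r ∈ nhds (0 : ℂ × ℂ)) ∧
          ∀ p ∈ Metric.ball (0 : ℂ × ℂ) r,
            (fun (τ : ℂ) (w : ℂ × ℂ) => w.1 ^ 3 * w.2 + s * w.1 ^ 2 * w.2 ^ 3 + τ * w.1 * w.2 ^ 6 + w.2 ^ 7) t (H (t, p)) =
            (fun (τ : ℂ) (w : ℂ × ℂ) => w.1 ^ 3 * w.2 + s * w.1 ^ 2 * w.2 ^ 3 + τ * w.1 * w.2 ^ 6 + w.2 ^ 7) t₀ p := by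
  obtain ⟨δ, hδ, K, V, hV, hV0, hVF⟩ := exists_lipschitz_lift_Z10 hs t₀
  obtain ⟨ε, hε, γ, hγcont, hγ⟩ := exists_flow_of_lipschitzOnWith hδ hV hV0
  refine ⟨Metric.ball t₀ ε, Metric.ball_mem_nhds _ hε, ε, 2, hε, one_le_two,
    fun u => γ (u.1 - t₀) u.2 1, ?_, fun t ht => ?_⟩
  · refine hγcont.comp (f := fun u : ℂ × (ℂ × ℂ) => (u.1 - t₀, u.2)) (by fun_prop) fun u hu => ?_
    rw [mem_closedBall_zero_iff, Prod.norm_mk, max_le_iff, ← dist_eq_norm]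
    exact ⟨(Metric.mem_ball.1 hu.1).le, (mem_ball_zero_iff.1 hu.2).le⟩
  have hc : ‖t - t₀‖ ≤ ε := by
    rw [← dist_eq_norm]
    exact (Metric.mem_ball.1 ht).le
  obtain ⟨h0, htraj, hclose⟩ := hγ (t - t₀) hc
  have hball : ∀ p ∈ Metric.ball (0 : ℂ × ℂ) ε, ‖p‖ ≤ ε := fun p hp => (mem_ball_zero_iff.1 hp).le
  refine ⟨h0, fun p hp q hq => ?_, ?_, fun p hp => ?_⟩
  · have h := hclose p (hball p hp) q (hball q hq)
    have h1 := norm_sub_norm_le (γ (t - t₀) p 1 - γ (t - t₀) q 1) (p - q)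
    have h2 := norm_sub_norm_le (p - q) (γ (t - t₀) p 1 - γ (t - t₀) q 1)
    rw [norm_sub_rev (p - q)] at h2
    constructor <;> dsimp only <;> linarith [norm_nonneg (p - q)]
  · have happ : ApproximatesLinearOn (fun p => γ (t - t₀) p 1)
        ((ContinuousLinearEquiv.refl ℂ (ℂ × ℂ) : (ℂ × ℂ) ≃L[ℂ] (ℂ × ℂ)) : (ℂ × ℂ) →L[ℂ] (ℂ × ℂ))
        (Metric.ball 0 ε) (1 / 2) := fun p hp q hq => by
      simpa using hclose p (hball p hp) q (hball q hq)
    have h := happ.image_mem_nhds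
      (ContinuousLinearEquiv.refl ℂ (ℂ × ℂ)).toNonlinearRightInverse
      (Metric.ball_mem_nhds 0 hε) (Or.inr ?_)
    · rwa [h0] at h
    · change (1 / 2 : NNReal) < ‖ContinuousLinearMap.id ℂ (ℂ × ℂ)‖₊⁻¹
      rw [show ‖ContinuousLinearMap.id ℂ (ℂ × ℂ)‖₊ = 1 from
        NNReal.eq ContinuousLinearMap.norm_id, inv_one]
      exact one_half_lt_one
  · obtain ⟨hp0, hp1⟩ := htraj p (hball p hp)
    have hd : ∀ τ ∈ Set.Icc (0 : ℝ) 1, HasDerivWithinAt (fun σ : ℝ =>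
        (γ (t - t₀) p σ).1 ^ 3 * (γ (t - t₀) p σ).2
        + s * (γ (t - t₀) p σ).1 ^ 2 * (γ (t - t₀) p σ).2 ^ 3
        + (t₀ + σ * (t - t₀)) * (γ (t - t₀) p σ).1 * (γ (t - t₀) p σ).2 ^ 6
        + (γ (t - t₀) p σ).2 ^ 7) 0 (Set.Icc 0 1) τ := by
      intro τ hτ
      obtain ⟨hmem, hder⟩ := hp1 τ hτ
      have hX : HasDerivWithinAt (fun σ => (γ (t - t₀) p σ).1)
          ((t - t₀) * (V (t₀ + τ * (t - t₀), γ (t - t₀) p τ)).1) (Set.Icc 0 1) τ := by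
        simpa using hder.hasFDerivWithinAt.fst.hasDerivWithinAt
      have hY : HasDerivWithinAt (fun σ => (γ (t - t₀) p σ).2)
          ((t - t₀) * (V (t₀ + τ * (t - t₀), γ (t - t₀) p τ)).2) (Set.Icc 0 1) τ := by
        simpa using hder.hasFDerivWithinAt.snd.hasDerivWithinAt
      have hT : HasDerivWithinAt (fun σ : ℝ => t₀ + σ * (t - t₀)) (t - t₀) (Set.Icc 0 1) τ := by
        simpa using ((Complex.ofRealCLM.hasDerivWithinAt (s := Set.Icc 0 1) (x := τ)).mul_const
          (t - t₀)).const_add t₀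
      have h := ((((hX.pow 3).mul hY).add (((hX.pow 2).const_mul s).mul (hY.pow 3))).add
        ((hT.mul hX).mul (hY.pow 6))).add (hY.pow 7)
      refine h.congr_deriv ?_
      simp only [Pi.pow_apply, Pi.mul_apply]
      push_cast
      linear_combination (t - t₀) * hVF _ hmem
    have h := norm_image_sub_le_of_norm_deriv_le_segment_01' hd (C := 0) (by simp)
    rw [norm_le_zero_iff, sub_eq_zero] at h
    simpa [hp0] using h
end
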